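/- Let A be the set of pairs α = (θ,λ), where λ runs over a set of representatives of the G×G orbits in J* and θ runs over Irr_L(H_{GλG}), and let χ_α be the character induced to G from the character Σ_{p∈L} ξ_{θ,pλ} of the subgroup H_{GλG} ⋉ U_{λ,rt}, where ξ_{θ,pλ}(h(1+x)) = θ(h)·ε^{(pλ)(x)}. For h ∈ L let J_h = {x ∈ J : μ(x) = 0 for every μ ∈ J* lying in some orbit GνG all of whose elements are fixed by Ad_h*}, and let π_h : J → J/J_h be the quotient map. Let B be the set of pairs β = (h,ω), where h runs over a set of representatives of the conjugacy classes of L and ω runs over the G×G orbits in J/J_h, and set K_β = Cl_L(h)·(1+π_h^{-1}(ω)) = {rhr^{-1}(1+x) : r ∈ L, π_h(x) ∈ ω}. Then the pair ({χ_α : α ∈ A}, {K_β : β ∈ B}) is a supercharacter theory of G = L ⋉ U: each χ_α is the character of a complex representation of G, the χ_α are pairwise orthogonal, the K_β form a partition of G one of whose parts is {1}, each χ_α is constant on each K_β, and |A| = |B|. -/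

import Mathlib

open scoped Classical

open scoped ComplexOrder in
/-- The value of a complex character at an inverse is the complex conjugate. -/
theorem Representation.character_inv_eq_conj {H V : Type*} [Group H] [Fintype H]
    [AddCommGroup V] [Module ℂ V] [FiniteDimensional ℂ V] (ρ : Representation ℂ H V) (g : H) :
    ρ.character g⁻¹ = (starRingEnd ℂ) (ρ.character g) := by
  let b := Module.finBasis ℂ V
  let A : H → Matrix (Fin (Module.finrank ℂ V)) (Fin (Module.finrank ℂ V)) ℂ :=
    fun h => LinearMap.toMatrix b b (ρ h)
  have hmul : ∀ h k, A (h * k) = A h * A k := fun h k => by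
    simp only [A, map_mul, LinearMap.toMatrix_mul]
  have hone : A 1 = 1 := by simp only [A, map_one, LinearMap.toMatrix_one]
  have htr : ∀ h, ρ.character h = (A h).trace := fun h =>
    LinearMap.trace_eq_matrix_trace ℂ b (ρ h)
  let P := ∑ h : H, (A h).conjTranspose * A h
  have hP : P.PosDef := by
    have h1 : P = 1 + ∑ h ∈ Finset.univ.erase (1 : H), (A h).conjTranspose * A h := by
      change ∑ h : H, (A h).conjTranspose * A h = _
      rw [← Finset.add_sum_erase Finset.univ _ (Finset.mem_univ (1 : H)), hone]
      simp
    rw [h1]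
    exact Matrix.PosDef.one.add_posSemidef
      (Matrix.posSemidef_sum _ fun h _ => Matrix.posSemidef_conjTranspose_mul_self (A h))
  have hinv : (A g).conjTranspose * P * A g = P := by
    simp only [P, Finset.mul_sum, Finset.sum_mul]
    refine Fintype.sum_equiv (Equiv.mulRight g) _ _ fun h => ?_
    simp only [Equiv.coe_mulRight, hmul, Matrix.conjTranspose_mul, Matrix.mul_assoc]
  obtain ⟨u, hu⟩ := hP.isUnit
  have h2 : (A g).conjTranspose = P * A g⁻¹ * (u⁻¹ : Units _).val := by
    rw [Units.eq_mul_inv_iff_mul_eq, hu]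
    conv_rhs => rw [← hinv]
    rw [Matrix.mul_assoc, Matrix.mul_assoc, ← hmul, mul_inv_cancel, hone, Matrix.mul_one]
  rw [htr, htr, starRingEnd_apply, ← Matrix.trace_conjTranspose, h2, Matrix.trace_mul_cycle,
    ← hu, Units.inv_mul, Matrix.one_mul]

theorem FDRep.character_inv_eq_conj {H : Type} [Group H] [Fintype H] (V : FDRep ℂ H) (g : H) :
    V.character g⁻¹ = (starRingEnd ℂ) (V.character g) :=
  Representation.character_inv_eq_conj V.ρ g

/-- Irreducible representations with different characters have orthogonal characters. -/
theorem FDRep.sum_character_mul_conj_eq_zero {H : Type} [Group H] [Fintype H] (V W : FDRep ℂ H)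
    [CategoryTheory.Simple V] [CategoryTheory.Simple W] (hne : V.character ≠ W.character) :
    ∑ g : H, V.character g * (starRingEnd ℂ) (W.character g) = 0 := by
  have hc : (Nat.card H : ℂ) ≠ 0 := Nat.cast_ne_zero.2 Nat.card_pos.ne'
  have := invertibleOfNonzero hc
  have h := FDRep.char_orthonormal V W
  rw [if_neg fun ⟨i⟩ => hne (FDRep.char_iso i)] at h
  simpa only [FDRep.character_inv_eq_conj] using
    (mul_eq_zero.1 h).resolve_left (inv_ne_zero hc)

theorem FDRep.simple_of_isIrreducible {H V : Type} [Group H] [Fintype H]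
    [AddCommGroup V] [Module ℂ V] [FiniteDimensional ℂ V] (ρ : Representation ℂ H V)
    [ρ.IsIrreducible] : CategoryTheory.Simple (FDRep.of ρ) := by
  have hc : (Nat.card H : ℂ) ≠ 0 := Nat.cast_ne_zero.2 Nat.card_pos.ne'
  have := invertibleOfNonzero hc
  rw [FDRep.simple_iff_char_is_norm_one]
  have h := Representation.char_orthonormal ρ ρ
  rw [if_pos ⟨Representation.Equiv.refl ρ⟩, inv_mul_eq_one₀ hc] at h
  exact h.symm

/-- A class function orthogonal to the character of an irreducible representation acts by zero
on that representation. -/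
theorem Representation.sum_smul_eq_zero_of_isIrreducible {H V : Type*} [Group H] [Fintype H]
    [AddCommGroup V] [Module ℂ V] [FiniteDimensional ℂ V] (ρ : Representation ℂ H V)
    [ρ.IsIrreducible] (f : H → ℂ) (hf : ∀ g h, f (h * g * h⁻¹) = f g)
    (h0 : ∑ g, f g * ρ.character g⁻¹ = 0) : ∑ g, f g • ρ g⁻¹ = 0 := by
  let T : V →ₗ[ℂ] V := ∑ g, f g • ρ g⁻¹
  have hT : ∀ h, T ∘ₗ ρ h = ρ h ∘ₗ T := fun h => by
    change T * ρ h = ρ h * T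
    simp only [T, Finset.sum_mul, Finset.mul_sum, smul_mul_assoc, mul_smul_comm, ← map_mul]
    refine Fintype.sum_equiv (MulAut.conj h⁻¹).toEquiv _ _ fun g => ?_
    have : f (h⁻¹ * g * h⁻¹⁻¹) = f g := hf _ _
    simp only [MulEquiv.toEquiv_eq_coe, EquivLike.coe_coe, MulAut.conj_apply, this]
    congr 2
    group
  let T' : Representation.IntertwiningMap ρ ρ := ⟨T, hT⟩
  obtain ⟨c, hc⟩ := (Representation.IsIrreducible.algebraMap_intertwiningMap_bijective_of_isAlgClosed
    (ρ := ρ)).2 T'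
  have hTc : T = c • LinearMap.id := by
    have := congrArg Representation.IntertwiningMap.toLinearMap hc
    rw [← show T'.toLinearMap = T from rfl, ← this]
    rfl
  have htr : LinearMap.trace ℂ V T = 0 := by
    rw [← h0]
    simp [T, Representation.character]
  have hn : (Module.finrank ℂ V : ℂ) ≠ 0 := by
    have : Nontrivial V := by
      by_contra hV
      rw [not_nontrivial_iff_subsingleton] at hV
      have := (inferInstance : ρ.IsIrreducible)
      have h2 : (⊥ : Subrepresentation ρ) ≠ ⊤ := bot_ne_top
      exact h2 (SetLike.ext fun x => by
        rw [Subsingleton.elim x 0]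
        exact ⟨fun _ => zero_mem (⊤ : Subrepresentation ρ).toSubmodule,
          fun _ => zero_mem (⊥ : Subrepresentation ρ).toSubmodule⟩)
    exact Nat.cast_ne_zero.2 Module.finrank_pos.ne'
  rw [hTc] at htr
  simp only [map_smul, LinearMap.trace_id, smul_eq_mul, mul_eq_zero, hn, or_false] at htr
  change T = 0
  rw [hTc, htr, zero_smul]


/-- A class function orthogonal to all irreducible characters acts by zero on every simple module
over the group algebra. -/
theorem FDRep.sum_single_smul_eq_zero_of_isSimpleModule {H : Type} [Group H] [Fintype H]
    (f : H → ℂ) (hf : ∀ g h, f (h * g * h⁻¹) = f g)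
    (h0 : ∀ V : FDRep ℂ H, CategoryTheory.Simple V →
      ∑ g, f g * (starRingEnd ℂ) (V.character g) = 0)
    (M : Type) [AddCommGroup M] [Module ℂ M] [Module (MonoidAlgebra ℂ H) M]
    [IsScalarTower ℂ (MonoidAlgebra ℂ H) M]
    [hs : IsSimpleModule (MonoidAlgebra ℂ H) M] (x : M) :
    (∑ g, MonoidAlgebra.single g⁻¹ (f g) : MonoidAlgebra ℂ H) • x = 0 := by
  have : FiniteDimensional ℂ M := Module.Finite.trans (MonoidAlgebra ℂ H) _
  let ρ : Representation ℂ H M := Representation.ofModule' M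
  have hρ : ∀ (a : MonoidAlgebra ℂ H) (y : M), ρ.asAlgebraHom a y = a • y := fun a y => by
    simp [ρ, Representation.asAlgebraHom, Representation.ofModule']
  have : ρ.IsIrreducible := by
    rw [Representation.irreducible_iff_isSimpleModule_asModule]
    let e : ρ.asModule ≃ₗ[MonoidAlgebra ℂ H] M :=
      { ρ.asModuleEquiv with
        map_smul' := fun a y => hρ a (ρ.asModuleEquiv y) }
    exact IsSimpleModule.congr e
  have h1 := ρ.sum_smul_eq_zero_of_isIrreducible f hf (by
    simp only [Representation.character_inv_eq_conj]
    exact h0 (FDRep.of ρ) (FDRep.simple_of_isIrreducible ρ))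
  have h2 : ρ.asAlgebraHom (∑ g, MonoidAlgebra.single g⁻¹ (f g)) = 0 := by
    rw [← h1]
    simp only [map_sum, Representation.asAlgebraHom_single]
  rw [← hρ, h2, LinearMap.zero_apply]

/-- A class function orthogonal to all irreducible characters vanishes. -/
theorem FDRep.eq_zero_of_forall_simple {H : Type} [Group H] [Fintype H]
    (f : H → ℂ) (hf : ∀ g h, f (h * g * h⁻¹) = f g)
    (h0 : ∀ V : FDRep ℂ H, CategoryTheory.Simple V →
      ∑ g, f g * (starRingEnd ℂ) (V.character g) = 0) : f = 0 := by
  have ha : (∑ g, MonoidAlgebra.single g⁻¹ (f g) : MonoidAlgebra ℂ H) = 0 := by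
    have hJ : Ring.jacobson (MonoidAlgebra ℂ H) = ⊥ :=
      IsSemisimpleModule.jacobson_eq_bot (MonoidAlgebra ℂ H) (MonoidAlgebra ℂ H)
    rw [← Submodule.mem_bot (MonoidAlgebra ℂ H), ← hJ, Ring.jacobson_eq_sInf_isMaximal,
      Submodule.mem_sInf]
    intro (m : Ideal (MonoidAlgebra ℂ H)) (hm : m.IsMaximal)
    have hs : IsSimpleModule (MonoidAlgebra ℂ H) (MonoidAlgebra ℂ H ⧸ m) :=
      isSimpleModule_iff_isCoatom.2 hm.1
    have h1 := FDRep.sum_single_smul_eq_zero_of_isSimpleModule f hf h0 (MonoidAlgebra ℂ H ⧸ m)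
      (Submodule.Quotient.mk 1)
    rwa [← Submodule.Quotient.mk_smul, smul_eq_mul, mul_one, Submodule.Quotient.mk_eq_zero] at h1
  funext g
  have := congrArg (fun a : MonoidAlgebra ℂ H => a.coeff g⁻¹) ha
  simpa [Finsupp.single_apply] using this

/-- The induced class function of a character is a character. -/
theorem FDRep.exists_character_eq_induced {G : Type} [Group G] [Fintype G] (S : Subgroup G)
    (V : FDRep ℂ S) : ∃ W : FDRep ℂ G, ∀ g, W.character g = (Nat.card S : ℂ)⁻¹ *
      ∑ s : G, if h : s * g * s⁻¹ ∈ S then V.character ⟨s * g * s⁻¹, h⟩ else 0 := by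
  let R : Representation ℂ G (G → V) :=
    { toFun := fun g => LinearMap.funLeft ℂ V (fun x => x * g)
      map_one' := by ext; simp [LinearMap.funLeft]
      map_mul' := fun a b => by ext; simp [LinearMap.funLeft, mul_assoc] }
  let Y : Submodule ℂ (G → V) :=
    { carrier := {f | ∀ (s : S) (x : G), f (s * x) = V.ρ s (f x)}
      add_mem' := fun {a b} ha hb s x => by simp [ha s x, hb s x]
      zero_mem' := fun s x => by simp
      smul_mem' := fun c f hf s x => by simp [hf s x] }
  let P : (G → V) →ₗ[ℂ] (G → V) :=
    { toFun := fun f x => (Nat.card S : ℂ)⁻¹ • ∑ s : S, V.ρ s⁻¹ (f (s * x))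
      map_add' := fun a b => by ext x; simp [Finset.sum_add_distrib]
      map_smul' := fun c f => by ext x; simp [Finset.smul_sum, smul_comm c] }
  have hPY : ∀ f, P f ∈ Y := fun f t x => by
    simp only [P, LinearMap.coe_mk, AddHom.coe_mk, map_smul, map_sum]
    congr 1
    refine Fintype.sum_equiv (Equiv.mulRight t) _ _ fun s => ?_
    simp [mul_assoc, ← Module.End.mul_apply, ← map_mul]
  have hc : (Nat.card S : ℂ) ≠ 0 := Nat.cast_ne_zero.2 Nat.card_pos.ne'
  have hYP : ∀ f ∈ Y, P f = f := fun f hf => by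
    funext x
    have : ∀ s : S, V.ρ s⁻¹ (f (s * x)) = f x := fun s => by
      rw [hf s x, ← Module.End.mul_apply, ← map_mul]; simp
    simp only [P, LinearMap.coe_mk, AddHom.coe_mk, this]
    simp [← Nat.card_eq_fintype_card, ← Nat.cast_smul_eq_nsmul ℂ, smul_smul, hc]
  have hRY : ∀ g, ∀ f ∈ Y, R g f ∈ Y := fun g f hf s x => by
    have := hf s (x * g)
    simpa [R, LinearMap.funLeft, mul_assoc] using this
  let ρ : Representation ℂ G Y :=
    { toFun := fun g => (R g).restrict (hRY g)
      map_one' := by ext; simp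
      map_mul' := fun a b => by ext; simp }
  refine ⟨FDRep.of ρ, fun g => ?_⟩
  let π : (G → V) →ₗ[ℂ] Y := P.codRestrict Y hPY
  have h1 : (FDRep.of ρ).character g = LinearMap.trace ℂ (G → V) (P ∘ₗ R g) := by
    have e1 : P ∘ₗ R g = Y.subtype ∘ₗ (π ∘ₗ R g) := rfl
    have e2 : (π ∘ₗ R g) ∘ₗ Y.subtype = ρ g := by
      refine LinearMap.ext fun f => Subtype.ext ?_
      exact hYP _ (hRY g f f.2)
    rw [e1, LinearMap.trace_comp_comm', e2]
    rfl
  have h2 : P ∘ₗ R g = ∑ x : G, (P ∘ₗ R g ∘ₗ LinearMap.single ℂ (fun _ : G => V) x) ∘ₗ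
      LinearMap.proj x := by
    refine LinearMap.ext fun f => ?_
    simp only [LinearMap.sum_apply, LinearMap.comp_apply, ← map_sum]
    congr 2
    exact (Finset.univ_sum_single f).symm
  rw [h1, h2, map_sum, Finset.mul_sum]
  refine Finset.sum_congr rfl fun x _ => ?_
  rw [LinearMap.trace_comp_comm']
  have h3 : ∀ s : S, ∀ v : V, (R g (LinearMap.single ℂ (fun _ : G => V) x v)) (s * x) =
      if (s : G)⁻¹ = x * g * x⁻¹ then v else 0 := fun s v => by
    simp only [R, MonoidHom.coe_mk, OneHom.coe_mk, LinearMap.funLeft_apply,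
      LinearMap.single_apply, Pi.single_apply]
    congr 1
    rw [eq_iff_iff, inv_eq_iff_mul_eq_one, ← mul_assoc, ← mul_assoc, mul_inv_eq_one]
  split_ifs with h
  · have : LinearMap.proj x ∘ₗ (P ∘ₗ R g ∘ₗ LinearMap.single ℂ (fun _ : G => V) x) =
        (Nat.card S : ℂ)⁻¹ • V.ρ ⟨x * g * x⁻¹, h⟩ := by
      refine LinearMap.ext fun v => ?_
      simp only [LinearMap.comp_apply, P, LinearMap.coe_mk, AddHom.coe_mk, LinearMap.proj_apply, h3,
        LinearMap.smul_apply]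
      congr 1
      rw [Finset.sum_eq_single (⟨x * g * x⁻¹, h⟩⁻¹ : S)]
      · simp
      · intro s _ hs
        rw [if_neg, map_zero]
        exact fun e => hs (inv_eq_iff_eq_inv.1 (Subtype.ext e))
      · simp
    rw [this]
    simp [FDRep.character]
  · have : LinearMap.proj x ∘ₗ (P ∘ₗ R g ∘ₗ LinearMap.single ℂ (fun _ : G => V) x) = 0 := by
      refine LinearMap.ext fun v => ?_
      simp only [LinearMap.comp_apply, P, LinearMap.coe_mk, AddHom.coe_mk, LinearMap.proj_apply, h3]
      rw [Finset.sum_eq_zero, smul_zero, LinearMap.zero_apply]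
      intro s _
      rw [if_neg, map_zero]
      exact fun e => h (e ▸ (s⁻¹).2)
    rw [this]
    simp

/-- A finite sum of characters is a character. -/
theorem FDRep.exists_character_eq_sum {G ι : Type*} [Group G] (s : Finset ι)
    (f : ι → G → ℂ) (hf : ∀ i ∈ s, ∃ W : FDRep ℂ G, ∀ g, f i g = W.character g) :
    ∃ W : FDRep ℂ G, ∀ g, ∑ i ∈ s, f i g = W.character g := by
  induction s using Finset.induction_on with
  | empty =>
    refine ⟨FDRep.of (1 : Representation ℂ G PUnit), fun g => ?_⟩
    change _ = LinearMap.trace ℂ PUnit _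
    rw [Subsingleton.elim ((FDRep.of (1 : Representation ℂ G PUnit)).ρ g) 0, map_zero]
    rfl
  | insert i s hi ih =>
    obtain ⟨W, hW⟩ := ih fun j hj => hf j (Finset.mem_insert_of_mem hj)
    obtain ⟨V, hV⟩ := hf i (Finset.mem_insert_self i s)
    refine ⟨FDRep.of (Representation.prod V.ρ W.ρ), fun g => ?_⟩
    rw [Finset.sum_insert hi, hW, hV]
    exact (LinearMap.trace_prodMap' (V.ρ g) (W.ρ g)).symm

/-- Pairwise orthogonal nonzero functions, constant on the fibres of a surjection `b` and complete
among the functions with this property, are as many as the fibres. -/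
theorem natCard_eq_of_orthogonal_of_complete {A B G : Type*} [Fintype G] {b : G → B}
    (hb : Function.Surjective b) (χ : A → G → ℂ) (hne : ∀ α, χ α ≠ 0)
    (horth : ∀ α α', α ≠ α' → ∑ g, χ α g * (starRingEnd ℂ) (χ α' g) = 0)
    (hconst : ∀ α g g', b g = b g' → χ α g = χ α g')
    (hcomp : ∀ f : B → ℂ, (∀ α, ∑ g, f (b g) * (starRingEnd ℂ) (χ α g) = 0) → f = 0) :
    Nat.card A = Nat.card B := by
  have : Finite B := Finite.of_surjective b hb
  have := Fintype.ofFinite B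
  let X : A → B → ℂ := fun α β => χ α (Function.surjInv hb β)
  have hX : ∀ α g, X α (b g) = χ α g := fun α g => hconst α _ _ (Function.surjInv_eq hb _)
  have hnorm : ∀ α, ∑ g, χ α g * (starRingEnd ℂ) (χ α g) ≠ 0 := fun α h0 => hne α <| by
    simp only [Complex.mul_conj] at h0
    rw [← Complex.ofReal_sum, Complex.ofReal_eq_zero,
      Finset.sum_eq_zero_iff_of_nonneg fun g _ => Complex.normSq_nonneg _] at h0
    exact funext fun g => Complex.normSq_eq_zero.1 (h0 g (Finset.mem_univ g))
  have hli : LinearIndependent ℂ X := by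
    rw [linearIndependent_iff']
    intro s c hc α hα
    have h1 : ∑ g, (∑ i ∈ s, c i • X i) (b g) * (starRingEnd ℂ) (χ α g) = 0 := by
      simp only [hc, Pi.zero_apply, zero_mul, Finset.sum_const_zero]
    simp only [Finset.sum_apply, Pi.smul_apply, hX, Finset.sum_mul, smul_eq_mul] at h1
    rw [Finset.sum_comm] at h1
    simp only [mul_assoc, ← Finset.mul_sum] at h1
    rw [Finset.sum_eq_single_of_mem α hα fun i _ hi => by rw [horth i α hi, mul_zero]] at h1
    rw [mul_eq_zero] at h1
    exact h1.resolve_right (hnorm α)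
  have : Finite A := hli.finite
  have := Fintype.ofFinite A
  let T : (B → ℂ) →ₗ[ℂ] (A → ℂ) :=
    { toFun := fun f α => ∑ g, f (b g) * (starRingEnd ℂ) (χ α g)
      map_add' := fun f f' => by
        funext α
        simp only [Pi.add_apply, add_mul, Finset.sum_add_distrib]
      map_smul' := fun c f => by
        funext α
        simp only [Pi.smul_apply, smul_eq_mul, mul_assoc, Finset.mul_sum, RingHom.id_apply] }
  have hT : Function.Injective T := (injective_iff_map_eq_zero T).2 fun f hf =>
    hcomp f fun α => congrFun hf α
  have h1 := hli.fintype_card_le_finrank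
  have h2 := LinearMap.finrank_le_finrank_of_injective hT
  rw [Module.finrank_fintype_fun_eq_card] at h1
  rw [Module.finrank_fintype_fun_eq_card, Module.finrank_fintype_fun_eq_card] at h2
  rw [Nat.card_eq_fintype_card, Nat.card_eq_fintype_card]
  exact le_antisymm h1 h2

section OrbitSums

variable {L : Type} [Group L]

/-- `ψ` is the extension by zero of an irreducible character of the subgroup with underlying
set `H`. -/
def IsIrrOn (H : Set L) (ψ : L → ℂ) : Prop :=
  (∀ h : L, h ∉ H → ψ h = 0) ∧
  ∃ H₀ : Subgroup L, (H₀ : Set L) = H ∧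
    ∃ W : FDRep ℂ ↥H₀, CategoryTheory.Simple W ∧ ∀ h : ↥H₀, ψ ↑h = W.character h

/-- `θ` is the extension by zero of a sum over an `L`-orbit of irreducible characters of the
subgroup with underlying set `H`. -/
def IsOrbitSum (H : Set L) (θ : L → ℂ) : Prop :=
  ∃ Sfin : Finset (L → ℂ),
    (∀ ψ ∈ Sfin, IsIrrOn H ψ) ∧
    (∃ ψ₀ ∈ Sfin, ∀ ψ : L → ℂ,
      ψ ∈ Sfin ↔ ∃ r : L, ∀ h : L, ψ h = ψ₀ (r * h * r⁻¹)) ∧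
    ∀ h : L, θ h = ∑ ψ ∈ Sfin, ψ h

theorem IsIrrOn.exists_fdRep {H : Subgroup L} {ψ : L → ℂ} (hψ : IsIrrOn (H : Set L) ψ) :
    ∃ W : FDRep ℂ H, CategoryTheory.Simple W ∧ ∀ h : H, ψ h = W.character h := by
  obtain ⟨-, H₀, h₀, hW⟩ := hψ
  obtain rfl := SetLike.coe_injective h₀
  exact hW

variable [Fintype L]

theorem sum_eq_sum_subgroup {H : Subgroup L} {f : L → ℂ} (hf : ∀ h ∉ H, f h = 0) :
    ∑ h, f h = ∑ h : H, f h := by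
  rw [← Finset.sum_subtype (Finset.univ.filter (· ∈ H)) (by simp)]
  exact (Finset.sum_filter_of_ne fun h _ hne => by_contra fun h1 => hne (hf h h1)).symm

theorem IsIrrOn.conj {H : Subgroup L} [H.Normal] {ψ : L → ℂ} (hψ : IsIrrOn (H : Set L) ψ) (r : L) :
    IsIrrOn (H : Set L) fun h => ψ (r * h * r⁻¹) := by
  obtain ⟨W, hW, e⟩ := hψ.exists_fdRep
  refine ⟨fun h hh => hψ.1 _ fun h1 => hh ?_, H, rfl,
    FDRep.of (W.ρ.comp (MulAut.conjNormal r : MulAut H).toMonoidHom), ?_, fun h => ?_⟩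
  · simpa [mul_assoc] using ‹H.Normal›.conj_mem _ h1 r⁻¹
  · rw [FDRep.simple_iff_char_is_norm_one] at hW ⊢
    rw [← hW]
    refine Fintype.sum_equiv (MulAut.conjNormal r : MulAut H).toEquiv _ _ fun h => ?_
    rw [MulEquiv.toEquiv_eq_coe, MulEquiv.coe_toEquiv, ← map_inv]
    rfl
  · have := e (MulAut.conjNormal r h)
    rw [MulAut.conjNormal_apply] at this
    exact this

theorem IsIrrOn.sum_mul_conj_eq_zero {H : Subgroup L} {ψ φ : L → ℂ} (hψ : IsIrrOn (H : Set L) ψ)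
    (hφ : IsIrrOn (H : Set L) φ) (hne : ψ ≠ φ) : ∑ h, ψ h * (starRingEnd ℂ) (φ h) = 0 := by
  obtain ⟨V, hV, eV⟩ := hψ.exists_fdRep
  obtain ⟨W, hW, eW⟩ := hφ.exists_fdRep
  rw [sum_eq_sum_subgroup (H := H) fun h hh => by rw [hψ.1 h hh, zero_mul]]
  simp only [eV, eW]
  refine FDRep.sum_character_mul_conj_eq_zero V W fun h => hne (funext fun x => ?_)
  by_cases hx : x ∈ H
  · exact (eV ⟨x, hx⟩).trans ((congrFun h _).trans (eW ⟨x, hx⟩).symm)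
  · rw [hψ.1 x hx, hφ.1 x hx]

theorem IsIrrOn.exists_pos {H : Subgroup L} {ψ : L → ℂ} (hψ : IsIrrOn (H : Set L) ψ) :
    ∃ n : ℕ, 0 < n ∧ ψ 1 = n := by
  obtain ⟨W, hW, e⟩ := hψ.exists_fdRep
  refine ⟨Module.finrank ℂ W, Nat.pos_of_ne_zero fun h0 => ?_, ?_⟩
  · rw [FDRep.simple_iff_char_is_norm_one] at hW
    have : Subsingleton W := Module.finrank_zero_iff.1 h0
    have hc : ∀ g, W.character g = 0 := fun g => by
      have : W.ρ g = 0 := Subsingleton.elim _ _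
      change LinearMap.trace ℂ W (W.ρ g) = 0
      rw [this, map_zero]
    simp only [hc, mul_zero, Finset.sum_const_zero] at hW
    exact Nat.cast_ne_zero.2 Nat.card_pos.ne' hW.symm
  · rw [← FDRep.char_one, ← e 1, Subgroup.coe_one]

namespace IsOrbitSum

variable {θ θ' : L → ℂ}

omit [Fintype L] in
theorem eq_zero {H : Set L} (hθ : IsOrbitSum H θ) {h : L} (hh : h ∉ H) : θ h = 0 := by
  obtain ⟨S, h1, -, h3⟩ := hθ
  rw [h3, Finset.sum_eq_zero fun ψ hψ => (h1 ψ hψ).1 h hh]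

omit [Fintype L] in
theorem apply_conj {H : Set L} (hθ : IsOrbitSum H θ) (r h : L) : θ (r * h * r⁻¹) = θ h := by
  obtain ⟨S, -, ⟨ψ₀, -, h2⟩, h3⟩ := hθ
  have hS : ∀ ψ ∈ S, ∀ k : L, (fun x => ψ (k * x * k⁻¹)) ∈ S := fun ψ hψ k => by
    obtain ⟨q, hq⟩ := (h2 ψ).1 hψ
    exact (h2 _).2 ⟨q * k, fun x => by simp only [hq]; congr 1; group⟩
  rw [h3, h3]
  refine Finset.sum_nbij' (fun ψ x => ψ (r * x * r⁻¹)) (fun ψ x => ψ (r⁻¹ * x * r))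
    (fun ψ hψ => hS ψ hψ r) (fun ψ hψ => by simpa using hS ψ hψ r⁻¹) ?_ ?_ fun _ _ => rfl
  all_goals
    intro ψ _
    funext x
    simp only [mul_assoc, inv_mul_cancel_left, mul_inv_cancel_left, inv_mul_cancel,
      mul_inv_cancel, mul_one]

theorem apply_one_ne_zero {H : Subgroup L} (hθ : IsOrbitSum (H : Set L) θ) : θ 1 ≠ 0 := by
  obtain ⟨S, h1, ⟨ψ₀, h0, -⟩, h3⟩ := hθ
  choose! n hn e using fun ψ hψ => (h1 ψ hψ).exists_pos
  rw [h3, Finset.sum_congr rfl e, ← Nat.cast_sum, Nat.cast_ne_zero]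
  exact (Finset.sum_pos hn ⟨ψ₀, h0⟩).ne'

theorem sum_mul_conj_eq_zero {H : Subgroup L} (hθ : IsOrbitSum (H : Set L) θ)
    (hθ' : IsOrbitSum (H : Set L) θ') (hne : θ ≠ θ') :
    ∑ h, θ h * (starRingEnd ℂ) (θ' h) = 0 := by
  obtain ⟨S, h1, ⟨ψ₀, -, h2⟩, h3⟩ := hθ
  obtain ⟨S', h1', ⟨ψ₀', -, h2'⟩, h3'⟩ := hθ'
  have hS : ∀ ψ ∈ S, ψ ∉ S' := fun ψ hψ hψ' => hne <| by
    obtain ⟨q, hq⟩ := (h2 ψ).1 hψ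
    obtain ⟨q', hq'⟩ := (h2' ψ).1 hψ'
    have e : S = S' := by
      ext φ
      rw [h2, h2']
      constructor
      · rintro ⟨r, hr⟩
        refine ⟨q' * q⁻¹ * r, fun h => ?_⟩
        have := (hq (q⁻¹ * (r * h * r⁻¹) * q)).symm.trans (hq' _)
        rw [hr]
        convert this using 2 <;> group
      · rintro ⟨r, hr⟩
        refine ⟨q * q'⁻¹ * r, fun h => ?_⟩
        have := (hq' (q'⁻¹ * (r * h * r⁻¹) * q')).symm.trans (hq _)
        rw [hr]
        convert this using 2 <;> group
    funext h
    rw [h3, h3', e]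
  simp only [h3, h3', map_sum, Finset.sum_mul_sum]
  rw [Finset.sum_comm]
  refine Finset.sum_eq_zero fun ψ hψ => ?_
  rw [Finset.sum_comm]
  refine Finset.sum_eq_zero fun φ hφ => (h1 ψ hψ).sum_mul_conj_eq_zero (h1' φ hφ) ?_
  rintro rfl
  exact hS ψ hψ hφ

/-- Every class function of `L` orthogonal to all orbit sums on `H` vanishes on `H`. -/
theorem eq_zero_of_forall {H : Subgroup L} [H.Normal] (f : L → ℂ)
    (hf : ∀ r h, f (r * h * r⁻¹) = f h)
    (h0 : ∀ θ, IsOrbitSum (H : Set L) θ → ∑ h, f h * (starRingEnd ℂ) (θ h) = 0)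
    {h : L} (hh : h ∈ H) : f h = 0 := by
  refine congrFun (FDRep.eq_zero_of_forall_simple (fun h : H => f h) (fun g k => ?_)
    fun V hV => ?_) ⟨h, hh⟩
  · simpa using hf k g
  · let ψ : L → ℂ := fun h => if hh : h ∈ H then V.character ⟨h, hh⟩ else 0
    have hψ : IsIrrOn (H : Set L) ψ :=
      ⟨fun h hh => dif_neg hh, H, rfl, V, hV, fun h => dif_pos h.2⟩
    let c : L → L → ℂ := fun r h => ψ (r * h * r⁻¹)
    have h1 := h0 (fun h => ∑ φ ∈ Finset.univ.image c, φ h) ⟨Finset.univ.image c, ?_,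
      ⟨ψ, ?_, fun φ => ?_⟩, fun _ => rfl⟩
    · have h2 : ∀ φ ∈ Finset.univ.image c, ∑ h, f h * (starRingEnd ℂ) (φ h) =
          ∑ h, f h * (starRingEnd ℂ) (ψ h) := fun φ hφ => by
        obtain ⟨r, -, rfl⟩ := Finset.mem_image.1 hφ
        refine Fintype.sum_equiv (MulAut.conj r).toEquiv _ _ fun h => ?_
        simp [c, hf]
      simp only [map_sum, Finset.mul_sum] at h1
      rw [Finset.sum_comm, Finset.sum_congr rfl h2, Finset.sum_const, nsmul_eq_mul,
        mul_eq_zero, Nat.cast_eq_zero, Finset.card_eq_zero] at h1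
      have h3 := h1.resolve_left (Finset.Nonempty.ne_empty ⟨c 1, by simp⟩)
      rw [sum_eq_sum_subgroup (H := H) fun h hh => by rw [hψ.1 h hh, map_zero, mul_zero]] at h3
      rw [← h3]
      exact Finset.sum_congr rfl fun h _ => by simp [ψ]
    · intro φ hφ
      obtain ⟨r, -, rfl⟩ := Finset.mem_image.1 hφ
      exact hψ.conj r
    · exact Finset.mem_image.2 ⟨1, Finset.mem_univ _, by simp [c]⟩
    · simp [c, funext_iff, eq_comm]

end IsOrbitSum

end OrbitSums

/-- An algebra group extension `G = L ⋉ (1 + J)`: commuting actions of `L` on both sides of `J`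
compatible with the product, and an identification of every element of `G` with a unique product
`ρ h * em x`. -/
structure AlgebraGroupExtension (F J L G : Type) [Field F] [NonUnitalRing J] [Module F J]
    [Group L] [Group G] where
  lact : L → J → J
  ract : J → L → J
  lact_linear : ∀ h : L, IsLinearMap F (lact h)
  ract_linear : ∀ h : L, IsLinearMap F (fun x => ract x h)
  lact_one : ∀ x : J, lact 1 x = x
  lact_mul : ∀ h k : L, ∀ x : J, lact (h * k) x = lact h (lact k x)
  ract_one : ∀ x : J, ract x 1 = x
  ract_mul : ∀ h k : L, ∀ x : J, ract x (h * k) = ract (ract x h) k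
  ract_lact : ∀ h k : L, ∀ x : J, ract (lact h x) k = lact h (ract x k)
  lact_mul_left : ∀ h : L, ∀ x y : J, lact h (x * y) = lact h x * y
  ract_mul_right : ∀ h : L, ∀ x y : J, ract (x * y) h = x * ract y h
  mul_lact : ∀ h : L, ∀ x y : J, x * lact h y = ract x h * y
  ρ : L →* G
  em : J → G
  em_mul : ∀ x y : J, em x * em y = em (x + y + x * y)
  split : Function.Bijective (fun p : L × J => ρ p.1 * em p.2)
  conj_em : ∀ (h : L) (x : J), ρ h * em x * (ρ h)⁻¹ = em (lact h (ract x h⁻¹))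

namespace AlgebraGroupExtension

variable {F J L G : Type} [Field F] [NonUnitalRing J] [Module F J] [Group L] [Group G]

section Actions

variable (D : AlgebraGroupExtension F J L G)

/-- The coordinates `(h, x)` of `ρ h * em x`. -/
noncomputable def dec : G → L × J :=
  @Function.invFun (L × J) G ⟨(1, 0)⟩ fun p : L × J => D.ρ p.1 * D.em p.2

theorem dec_apply (h : L) (x : J) : D.dec (D.ρ h * D.em x) = (h, x) :=
  @Function.leftInverse_invFun (L × J) G ⟨(1, 0)⟩ _ D.split.1 (h, x)

theorem exists_eq (g : G) : ∃ h x, g = D.ρ h * D.em x := by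
  obtain ⟨⟨h, x⟩, e⟩ := D.split.2 g
  exact ⟨h, x, e.symm⟩

theorem em_injective : Function.Injective D.em := fun x y h => by
  have := D.split.1 (a₁ := (1, x)) (a₂ := (1, y)) (by simp [h])
  exact (Prod.ext_iff.1 this).2

theorem em_zero : D.em 0 = 1 := by
  have := D.em_mul 0 0
  simpa using this

theorem exists_em_eq_inv [Finite J] (y : J) : ∃ c, D.em c = (D.em y)⁻¹ := by
  have hinj : Function.Injective fun x : J => y + x + y * x := fun a b h => by
    apply D.em_injective
    apply mul_left_cancel (a := D.em y)
    rw [D.em_mul, D.em_mul]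
    exact congrArg D.em h
  obtain ⟨c, hc⟩ := Finite.surjective_of_injective hinj 0
  refine ⟨c, eq_inv_of_mul_eq_one_right ?_⟩
  rw [D.em_mul, ← D.em_zero]
  exact congrArg D.em hc

theorem lact_add (h : L) (x y : J) : D.lact h (x + y) = D.lact h x + D.lact h y :=
  (D.lact_linear h).map_add x y

theorem ract_add (h : L) (x y : J) : D.ract (x + y) h = D.ract x h + D.ract y h :=
  (D.ract_linear h).map_add x y

theorem lact_inv_lact (h : L) (x : J) : D.lact h⁻¹ (D.lact h x) = x := by
  rw [← D.lact_mul, inv_mul_cancel, D.lact_one]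

theorem lact_lact_inv (h : L) (x : J) : D.lact h (D.lact h⁻¹ x) = x := by
  rw [← D.lact_mul, mul_inv_cancel, D.lact_one]

theorem ract_ract_inv (h : L) (x : J) : D.ract (D.ract x h) h⁻¹ = x := by
  rw [← D.ract_mul, mul_inv_cancel, D.ract_one]

theorem ract_inv_ract (h : L) (x : J) : D.ract (D.ract x h⁻¹) h = x := by
  rw [← D.ract_mul, inv_mul_cancel, D.ract_one]

theorem em_mul_rho (h : L) (x : J) :
    D.em x * D.ρ h = D.ρ h * D.em (D.lact h⁻¹ (D.ract x h)) := by
  have := D.conj_em h (D.lact h⁻¹ (D.ract x h))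
  rw [D.ract_lact, D.ract_ract_inv, D.lact_lact_inv] at this
  rw [← this, inv_mul_cancel_right]

theorem mul_apply (h k : L) (x y : J) : (D.ρ h * D.em x) * (D.ρ k * D.em y) =
    D.ρ (h * k) * D.em (D.lact k⁻¹ (D.ract x k) + y + D.lact k⁻¹ (D.ract x k) * y) := by
  rw [mul_assoc, ← mul_assoc (D.em x), D.em_mul_rho, mul_assoc, D.em_mul, ← mul_assoc, map_mul]

theorem sum_eq_sum_sum [Fintype L] [Fintype J] [Fintype G] {M : Type*} [AddCommMonoid M]
    (f : G → M) : ∑ g, f g = ∑ h, ∑ x, f (D.ρ h * D.em x) := by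
  rw [← Fintype.sum_prod_type', ← Fintype.sum_bijective _ D.split]
  intro p
  rfl

variable [SMulCommClass F J J] [IsScalarTower F J J]

/-- The left action of `G` on `J`. -/
noncomputable def lG (g : G) : J →ₗ[F] J :=
  (D.lact_linear (D.dec g).1).mk' _ ∘ₗ (LinearMap.id + LinearMap.mulLeft F (D.dec g).2)

/-- The right action of `G` on `J`. -/
noncomputable def rG (g : G) : J →ₗ[F] J :=
  (LinearMap.id + LinearMap.mulRight F (D.dec g).2) ∘ₗ (D.ract_linear (D.dec g).1).mk' _

omit [IsScalarTower F J J] in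
theorem lG_apply (h : L) (w x : J) : D.lG (D.ρ h * D.em w) x = D.lact h (x + w * x) := by
  simp [lG, D.dec_apply]

omit [SMulCommClass F J J] in
theorem rG_apply (h : L) (w x : J) :
    D.rG (D.ρ h * D.em w) x = D.ract x h + D.ract x h * w := by
  simp [rG, D.dec_apply]

omit [IsScalarTower F J J] in
theorem lG_rho (h : L) (x : J) : D.lG (D.ρ h) x = D.lact h x := by
  have := D.lG_apply h 0 x
  simpa [D.em_zero] using this

omit [SMulCommClass F J J] in
theorem rG_rho (h : L) (x : J) : D.rG (D.ρ h) x = D.ract x h := by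
  have := D.rG_apply h 0 x
  simpa [D.em_zero] using this

omit [IsScalarTower F J J] in
theorem lG_em (w x : J) : D.lG (D.em w) x = x + w * x := by
  have := D.lG_apply 1 w x
  simpa [D.lact_one] using this

omit [SMulCommClass F J J] in
theorem rG_em (w x : J) : D.rG (D.em w) x = x + x * w := by
  have := D.rG_apply 1 w x
  simpa [D.ract_one] using this

omit [IsScalarTower F J J] in
theorem lG_mul (a b : G) (x : J) : D.lG (a * b) x = D.lG a (D.lG b x) := by
  obtain ⟨h, y, rfl⟩ := D.exists_eq a
  obtain ⟨k, z, rfl⟩ := D.exists_eq b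
  rw [D.mul_apply, D.lG_apply, D.lG_apply, D.lG_apply, D.lact_mul]
  congr 1
  rw [D.mul_lact, ← D.lact_lact_inv k (D.ract y k * (x + z * x)), D.lact_mul_left, ← D.lact_add]
  congr 1
  simp only [add_mul, mul_add, mul_assoc]
  abel

omit [SMulCommClass F J J] in
theorem rG_mul (a b : G) (x : J) : D.rG (a * b) x = D.rG b (D.rG a x) := by
  obtain ⟨h, y, rfl⟩ := D.exists_eq a
  obtain ⟨k, z, rfl⟩ := D.exists_eq b
  rw [D.mul_apply, D.rG_apply, D.rG_apply, D.rG_apply, D.ract_mul, D.ract_add, D.ract_mul_right]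
  have : ∀ u : J, D.ract u k * D.lact k⁻¹ (D.ract y k) = u * D.ract y k := fun u => by
    rw [D.mul_lact, D.ract_ract_inv]
  simp only [add_mul, mul_add, ← mul_assoc, this]
  abel

omit [IsScalarTower F J J] in
theorem lG_one (x : J) : D.lG 1 x = x := by
  rw [← map_one D.ρ, D.lG_rho, D.lact_one]

omit [SMulCommClass F J J] in
theorem rG_one (x : J) : D.rG 1 x = x := by
  rw [← map_one D.ρ, D.rG_rho, D.ract_one]

theorem rG_lG (a b : G) (x : J) : D.rG b (D.lG a x) = D.lG a (D.rG b x) := by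
  obtain ⟨h, y, rfl⟩ := D.exists_eq a
  obtain ⟨k, z, rfl⟩ := D.exists_eq b
  simp only [D.lG_apply, D.rG_apply, D.ract_lact, D.ract_add, D.lact_add, D.lact_mul_left,
    D.ract_mul_right, mul_add, add_mul, mul_assoc]
  abel

/-- The set `J_{λ,rt}`. -/
def Jrt (l : Module.Dual F J) : Set J := {z : J | ∀ w : J, l (z * w) = 0}

/-- The two-sided orbit `GλG`. -/
def orbit (l : Module.Dual F J) : Set (Module.Dual F J) :=
  {μ | ∃ (k : L) (w : J) (k' : L) (w' : J), ∀ x : J,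
    μ x = l (D.ract (D.lact k' (x + w' * x)) k + D.ract (D.lact k' (x + w' * x)) k * w)}

/-- The functional `μ` is fixed by the coadjoint action of `r`. -/
def Fix (r : L) (μ : Module.Dual F J) : Prop := ∀ x : J, μ (D.ract (D.lact r⁻¹ x) r) = μ x

/-- The set `H_{GλG}`. -/
def Hset (l : Module.Dual F J) : Set L := {r : L | ∀ μ ∈ D.orbit l, D.Fix r μ}

/-- The set `J_h`. -/
def Jh (h : L) : Set J :=
  {x : J | ∀ μ : Module.Dual F J,
    (∃ ν : Module.Dual F J, μ ∈ D.orbit ν ∧ ∀ σ ∈ D.orbit ν, D.Fix h σ) → μ x = 0}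

/-- The two-sided orbit of an element of `J`. -/
def orb2 (x₀ : J) : Set J :=
  {y : J | ∃ (k : L) (w : J) (k' : L) (w' : J),
    y = D.ract (D.lact k (x₀ + w * x₀)) k' + D.ract (D.lact k (x₀ + w * x₀)) k' * w'}

/-- The functional `x ↦ l (a x b)`. -/
noncomputable def tr (a b : G) (l : Module.Dual F J) : Module.Dual F J :=
  l ∘ₗ D.rG b ∘ₗ D.lG a

theorem tr_apply (a b : G) (l : Module.Dual F J) (x : J) :
    D.tr a b l x = l (D.rG b (D.lG a x)) := rfl

theorem tr_tr (a b a' b' : G) (l : Module.Dual F J) :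
    D.tr a b (D.tr a' b' l) = D.tr (a' * a) (b * b') l := by
  ext x
  simp only [tr_apply, D.rG_lG, D.lG_mul, D.rG_mul]

theorem tr_one (l : Module.Dual F J) : D.tr 1 1 l = l := by
  ext x
  simp only [tr_apply, D.lG_one, D.rG_one]

theorem mem_orbit {l μ : Module.Dual F J} : μ ∈ D.orbit l ↔ ∃ a b : G, μ = D.tr a b l := by
  constructor
  · rintro ⟨k, w, k', w', h⟩
    refine ⟨D.ρ k' * D.em w', D.ρ k * D.em w, ?_⟩
    ext x
    rw [tr_apply, D.lG_apply, D.rG_apply, h]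
  · rintro ⟨a, b, rfl⟩
    obtain ⟨k', w', rfl⟩ := D.exists_eq a
    obtain ⟨k, w, rfl⟩ := D.exists_eq b
    refine ⟨k, w, k', w', fun x => ?_⟩
    rw [tr_apply, D.lG_apply, D.rG_apply]

theorem mem_orb2 {x y : J} : y ∈ D.orb2 x ↔ ∃ a b : G, y = D.rG b (D.lG a x) := by
  constructor
  · rintro ⟨k, w, k', w', h⟩
    refine ⟨D.ρ k * D.em w, D.ρ k' * D.em w', ?_⟩
    rw [D.lG_apply, D.rG_apply, h]
  · rintro ⟨a, b, rfl⟩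
    obtain ⟨k, w, rfl⟩ := D.exists_eq a
    obtain ⟨k', w', rfl⟩ := D.exists_eq b
    refine ⟨k, w, k', w', ?_⟩
    rw [D.lG_apply, D.rG_apply]

theorem tr_mem_orbit (a b : G) (l : Module.Dual F J) : D.tr a b l ∈ D.orbit l :=
  D.mem_orbit.2 ⟨a, b, rfl⟩

theorem mem_orbit_self (l : Module.Dual F J) : l ∈ D.orbit l :=
  D.mem_orbit.2 ⟨1, 1, (D.tr_one l).symm⟩

theorem tr_mem_orbit_of_mem (a b : G) {l μ : Module.Dual F J} (h : μ ∈ D.orbit l) :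
    D.tr a b μ ∈ D.orbit l := by
  obtain ⟨c, d, rfl⟩ := D.mem_orbit.1 h
  rw [tr_tr]
  exact D.tr_mem_orbit _ _ l

theorem mem_orbit_symm {l μ : Module.Dual F J} (h : μ ∈ D.orbit l) : l ∈ D.orbit μ := by
  obtain ⟨a, b, rfl⟩ := D.mem_orbit.1 h
  refine D.mem_orbit.2 ⟨a⁻¹, b⁻¹, ?_⟩
  rw [tr_tr, mul_inv_cancel, inv_mul_cancel, tr_one]

theorem orbit_eq {l μ : Module.Dual F J} (h : μ ∈ D.orbit l) : D.orbit μ = D.orbit l := by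
  have key : ∀ {l μ : Module.Dual F J}, μ ∈ D.orbit l → D.orbit μ ⊆ D.orbit l := by
    intro l μ h ν hν
    obtain ⟨a, b, rfl⟩ := D.mem_orbit.1 hν
    exact D.tr_mem_orbit_of_mem a b h
  exact (key h).antisymm (key (D.mem_orbit_symm h))

theorem Hset_eq {l μ : Module.Dual F J} (h : μ ∈ D.orbit l) : D.Hset μ = D.Hset l := by
  unfold Hset
  rw [D.orbit_eq h]

theorem conj_mem_Hset {l : Module.Dual F J} {r : L} (hr : r ∈ D.Hset l) (k : L) :
    k * r * k⁻¹ ∈ D.Hset l := by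
  intro μ hμ x
  have h := hr _ (D.tr_mem_orbit_of_mem (D.ρ k) (D.ρ k⁻¹) hμ) (D.lact k⁻¹ (D.ract x k))
  simp only [tr_apply, D.lG_rho, D.rG_rho, D.ract_lact, D.lact_lact_inv, D.ract_ract_inv] at h
  simpa only [mul_inv_rev, inv_inv, D.lact_mul, D.ract_mul, D.ract_lact, mul_assoc] using h

theorem conj_mem_Hset_iff {l : Module.Dual F J} {r k : L} :
    k * r * k⁻¹ ∈ D.Hset l ↔ r ∈ D.Hset l :=
  ⟨fun h => by simpa [mul_assoc] using D.conj_mem_Hset h k⁻¹, fun h => D.conj_mem_Hset h k⟩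

/-- The subgroup `H_{GλG}` of `L`. -/
def HL (l : Module.Dual F J) : Subgroup L where
  carrier := D.Hset l
  one_mem' := fun μ _ x => by rw [inv_one, D.lact_one, D.ract_one]
  mul_mem' := fun {a b} ha hb μ hμ x => by
    have h1 := hb μ hμ (D.ract (D.lact a⁻¹ x) a)
    rw [ha μ hμ x] at h1
    rw [← h1]
    simp only [mul_inv_rev, D.lact_mul, D.ract_mul, D.ract_lact]
  inv_mem' := fun {a} ha μ hμ x => by
    have h1 := ha μ hμ (D.ract (D.lact a x) a⁻¹)
    rw [inv_inv, ← h1]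
    simp only [D.ract_lact, D.ract_inv_ract, D.lact_inv_lact]

/-- The subspace of functionals whose orbit is fixed by `h`; it is dual to `J / J_h`. -/
def Mh (h : L) : Submodule F (Module.Dual F J) where
  carrier := {μ | h ∈ D.Hset μ}
  zero_mem' := fun μ hμ x => by
    obtain ⟨a, b, rfl⟩ := D.mem_orbit.1 hμ
    simp [tr_apply]
  add_mem' := fun {μ ν} hμ hν σ hσ x => by
    obtain ⟨a, b, rfl⟩ := D.mem_orbit.1 hσ
    have h1 := hμ _ (D.tr_mem_orbit a b μ) x
    have h2 := hν _ (D.tr_mem_orbit a b ν) x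
    simp only [tr_apply, LinearMap.add_apply] at h1 h2 ⊢
    rw [h1, h2]
  smul_mem' := fun c μ hμ σ hσ x => by
    obtain ⟨a, b, rfl⟩ := D.mem_orbit.1 hσ
    have h1 := hμ _ (D.tr_mem_orbit a b μ) x
    simp only [tr_apply, LinearMap.smul_apply] at h1 ⊢
    rw [h1]

theorem mem_Mh {h : L} {μ : Module.Dual F J} : μ ∈ D.Mh h ↔ h ∈ D.Hset μ := Iff.rfl

theorem mem_Jh {h : L} {x : J} : x ∈ D.Jh h ↔ ∀ μ ∈ D.Mh h, μ x = 0 := by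
  constructor
  · exact fun hx μ hμ => hx _ ⟨μ, D.mem_orbit_self μ, hμ⟩
  · rintro hx μ ⟨ν, hμ, hν⟩
    refine hx μ ?_
    rw [mem_Mh, D.Hset_eq hμ]
    exact hν

theorem tr_mem_Mh (a b : G) {h : L} {μ : Module.Dual F J} (hμ : μ ∈ D.Mh h) :
    D.tr a b μ ∈ D.Mh h := by
  rw [mem_Mh, D.Hset_eq (D.tr_mem_orbit a b μ)]
  exact hμ

theorem Jh_conj (h r : L) : D.Jh (r * h * r⁻¹) = D.Jh h := by
  ext x
  simp only [mem_Jh, mem_Mh, D.conj_mem_Hset_iff]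

theorem rG_lG_mem_Jh (a b : G) {h : L} {x : J} (hx : x ∈ D.Jh h) :
    D.rG b (D.lG a x) ∈ D.Jh h :=
  D.mem_Jh.2 fun _ hμ => D.mem_Jh.1 hx _ (D.tr_mem_Mh a b hμ)

theorem Jh_eq_coannihilator (h : L) : D.Jh h = ((D.Mh h).dualCoannihilator : Set J) := by
  ext x
  rw [mem_Jh]
  exact (Submodule.mem_dualCoannihilator x).symm

theorem mem_Mh_of_forall_Jh [Finite J] {h : L} {μ : Module.Dual F J}
    (hμ : ∀ x ∈ D.Jh h, μ x = 0) : μ ∈ D.Mh h := by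
  have : FiniteDimensional F J := Module.Finite.of_finite
  rw [← Subspace.dualCoannihilator_dualAnnihilator_eq (W := D.Mh h),
    Submodule.mem_dualAnnihilator]
  rwa [D.Jh_eq_coannihilator] at hμ

end Actions

section Characters

variable [Fintype J] [Fintype L] [Fintype G] (D : AlgebraGroupExtension F J L G)
  (ε : AddChar F ℂ)

/-- The extension by zero of `∑ p, ξ_{θ, pλ}` from the subgroup `H_{GλG} ⋉ U_{λ,rt}`. -/
noncomputable def xi (θ : L → ℂ) (l : Module.Dual F J) (s : G) : ℂ :=
  if (D.dec s).1 ∈ D.Hset l ∧ (D.dec s).2 ∈ Jrt l then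
    ∑ p : L, θ (D.dec s).1 * ε (l (D.ract (D.dec s).2 p))
  else 0

/-- The class function `χ_{θ, λ}`. -/
noncomputable def chi (θ : L → ℂ) (l : Module.Dual F J) (g : G) : ℂ :=
  ((Nat.card ↥(D.Hset l) * Nat.card ↥(Jrt l) : ℕ) : ℂ)⁻¹ * ∑ s : G, D.xi ε θ l (s * g * s⁻¹)

variable {ε}

omit [Fintype J] [Fintype L] [Fintype G] [Group L] [Group G] [NonUnitalRing J] [Module F J] in
theorem sum_addChar_eq_zero {V : Type*} [AddCommGroup V] [Module F V] [Fintype V] (hε : ε ≠ 1)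
    {μ : Module.Dual F V} (hμ : μ ≠ 0) :
    ∑ x, ε (μ x) = 0 := by
  have h := AddChar.sum_eq_zero_of_ne_one (ψ := ε.compAddMonoidHom μ.toAddMonoidHom) ?_
  · exact h
  · intro h1
    apply hε
    ext t
    obtain ⟨x, rfl⟩ := LinearMap.surjective hμ t
    exact DFunLike.congr_fun h1 x

omit [Fintype L] [Fintype G] [Group L] [Group G] in
/-- A function on `J` is zero if all its Fourier coefficients vanish. -/
theorem eq_zero_of_forall_sum_addChar [Finite F] (hε : ε ≠ 1) (f : J → ℂ)
    (h : ∀ μ : Module.Dual F J, ∑ x, f x * (starRingEnd ℂ) (ε (μ x)) = 0) : f = 0 := by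
  have : Finite (Module.Dual F J) := DFunLike.finite _
  have := Fintype.ofFinite (Module.Dual F J)
  funext y
  have h1 : ∑ μ : Module.Dual F J, ε (μ y) * ∑ x, f x * (starRingEnd ℂ) (ε (μ x)) = 0 := by
    simp only [h, mul_zero, Finset.sum_const_zero]
  have h2 : ∀ x, ∑ μ : Module.Dual F J, ε (μ y) * (f x * (starRingEnd ℂ) (ε (μ x))) =
      if x = y then (Fintype.card (Module.Dual F J) : ℂ) * f x else 0 := fun x => by
    have h3 : ∀ μ : Module.Dual F J, ε (μ y) * (f x * (starRingEnd ℂ) (ε (μ x))) =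
        f x * ε (Module.Dual.eval F J (y - x) μ) := fun μ => by
      rw [Module.Dual.eval_apply, map_sub, sub_eq_add_neg, AddChar.map_add_eq_mul,
        AddChar.map_neg_eq_conj]
      ring
    simp only [h3, ← Finset.mul_sum]
    split_ifs with hx
    · simp [hx, mul_comm]
    · rw [sum_addChar_eq_zero hε, mul_zero]
      exact fun h4 => hx (sub_eq_zero.1 ((Module.eval_apply_eq_zero_iff F _).1 h4)).symm
  simp only [Finset.mul_sum] at h1
  rw [Finset.sum_comm] at h1
  simpa [h2] using h1

variable [SMulCommClass F J J] [IsScalarTower F J J]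

omit [Fintype G] in
omit [Fintype J] [Fintype L] [IsScalarTower F J J] in
theorem exists_dual_ne_zero_of_notMem_Jrt {l : Module.Dual F J} {t : J} (ht : t ∉ Jrt l) (q : L) :
    ∃ μ : Module.Dual F J, μ ≠ 0 ∧ ∀ w, μ w = l (D.ract t q * w) := by
  refine ⟨l ∘ₗ LinearMap.mulLeft F (D.ract t q), fun h => ht fun w => ?_, fun w => rfl⟩
  have := DFunLike.congr_fun h (D.lact q⁻¹ w)
  simpa [D.mul_lact, D.ract_ract_inv] using this

theorem sum_ract_eq_sum_rG (hε : ε ≠ 1) (l : Module.Dual F J) (t : J) :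
    (if t ∈ Jrt l then ∑ q : L, ε (l (D.ract t q)) else 0) =
      (Fintype.card J : ℂ)⁻¹ * ∑ b : G, ε (l (D.rG b t)) := by
  rw [D.sum_eq_sum_sum]
  have hc : (Fintype.card J : ℂ) ≠ 0 := Nat.cast_ne_zero.2 Fintype.card_ne_zero
  simp only [D.rG_apply, map_add, AddChar.map_add_eq_mul, ← Finset.mul_sum]
  split_ifs with ht
  · have : ∀ q w, l (D.ract t q * w) = 0 := fun q w => by
      rw [← D.mul_lact]
      exact ht _
    simp [this, ← Finset.sum_mul, hc, mul_comm (∑ q : L, ε (l (D.ract t q)))]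
  · have : ∀ q, ∑ w, ε (l (D.ract t q * w)) = 0 := fun q => by
      obtain ⟨μ, hμ, e⟩ := D.exists_dual_ne_zero_of_notMem_Jrt ht q
      simpa only [e] using sum_addChar_eq_zero hε hμ
    simp [this]

variable (ε) in
/-- The sum of `ε ^ μ` over `G × G`, with `μ` running through the orbit of `l`. -/
noncomputable def Phi (l : Module.Dual F J) (x : J) : ℂ := ∑ a : G, ∑ b : G, ε (D.tr a b l x)

omit [Fintype L] [Fintype G] in
omit [SMulCommClass F J J] in
theorem exists_conj_eq (p h : L) (x y : J) : ∃ z, ∃ u : G,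
    (D.ρ p * D.em y) * (D.ρ h * D.em x) * (D.ρ p * D.em y)⁻¹ =
      D.ρ (p * h * p⁻¹) * D.em (D.lact p (D.ract z p⁻¹)) ∧
    z = D.rG u (x + D.lact h⁻¹ (D.ract y h) * x + (D.lact h⁻¹ (D.ract y h) - y)) := by
  obtain ⟨c, hc⟩ := D.exists_em_eq_inv y
  refine ⟨_, D.em c, ?_, rfl⟩
  set y' := D.lact h⁻¹ (D.ract y h) with hy'
  set z := D.rG (D.em c) (x + y' * x + (y' - y)) with hz
  have h1 : D.em z * D.em y = D.em y' * D.em x := by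
    rw [D.em_mul, D.em_mul]
    congr 1
    have : z + z * y = x + y' * x + (y' - y) := by
      rw [← D.rG_em, hz, ← D.rG_mul, hc, inv_mul_cancel, D.rG_one]
    rw [add_right_comm, this]
    abel
  have h2 : D.em y * D.ρ h * D.em x * (D.em y)⁻¹ = D.ρ h * D.em z := by
    rw [D.em_mul_rho, mul_inv_eq_iff_eq_mul, mul_assoc, mul_assoc, h1]
  rw [map_mul, map_mul, ← D.conj_em, map_inv]
  calc _ = D.ρ p * (D.em y * D.ρ h * D.em x * (D.em y)⁻¹) * (D.ρ p)⁻¹ := by group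
    _ = _ := by rw [h2]; group

omit [Fintype J] [Fintype L] in
theorem sum_conj_rG (h : L) (l : Module.Dual F J) (hh : h ∈ D.Hset l) (a u : G) (x y : J) :
    ∑ b : G, ε (l (D.rG b (D.lG a (D.rG u (x + y * x + (y - D.lact h (D.ract y h⁻¹))))))) =
      ∑ b : G, ε (D.tr (a * D.em y) b l x) := by
  refine Fintype.sum_equiv (Equiv.mulLeft u) _ _ fun b => ?_
  have h1 := hh _ (D.tr_mem_orbit a (u * b) l) (D.lact h (D.ract y h⁻¹))
  simp only [D.ract_inv_ract, D.lact_inv_lact] at h1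
  rw [← sub_eq_zero, ← map_sub] at h1
  rw [Equiv.coe_mulLeft, tr_apply, D.lG_mul, D.lG_em, ← D.rG_lG, ← D.rG_mul]
  change ε (D.tr a (u * b) l _) = ε (D.tr a (u * b) l _)
  rw [map_add, h1, add_zero]

theorem chi_apply (hε : ε ≠ 1) {θ : L → ℂ} {l : Module.Dual F J}
    (hθ : ∀ h ∉ D.Hset l, θ h = 0) (hθc : ∀ r h, θ (r * h * r⁻¹) = θ h) (h : L) (x : J) :
    D.chi ε θ l (D.ρ h * D.em x) =
      ((Nat.card ↥(D.Hset l) * Nat.card ↥(Jrt l) : ℕ) : ℂ)⁻¹ * (Fintype.card J : ℂ)⁻¹ *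
        (θ h * D.Phi ε l x) := by
  rw [chi, mul_assoc]
  congr 1
  by_cases hh : h ∈ D.Hset l
  · have key : ∀ p y, D.xi ε θ l ((D.ρ p * D.em y) * (D.ρ h * D.em x) * (D.ρ p * D.em y)⁻¹) =
        (Fintype.card J : ℂ)⁻¹ * (θ h *
          ∑ b, ε (D.tr (D.ρ p * D.em (D.lact h⁻¹ (D.ract y h))) b l x)) := fun p y => by
      obtain ⟨z, u, h1, h2⟩ := D.exists_conj_eq p h x y
      rw [h1, xi, D.dec_apply]
      have hh' : p * h * p⁻¹ ∈ D.Hset l := D.conj_mem_Hset hh p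
      simp only [hh', true_and, ← Finset.mul_sum, hθc]
      rw [← mul_zero (θ h), ← mul_ite, D.sum_ract_eq_sum_rG hε, mul_left_comm]
      congr 2
      have e : D.lact h (D.ract (D.lact h⁻¹ (D.ract y h)) h⁻¹) = y := by
        rw [D.ract_lact, D.ract_ract_inv, D.lact_lact_inv]
      rw [← D.sum_conj_rG h l hh (D.ρ p) (u * D.ρ p⁻¹), e, D.rG_mul, ← h2]
      refine Finset.sum_congr rfl fun b _ => ?_
      rw [D.lG_rho, D.rG_rho]
    rw [D.sum_eq_sum_sum]
    simp only [key, ← Finset.mul_sum]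
    congr 2
    rw [Phi, D.sum_eq_sum_sum]
    refine Finset.sum_congr rfl fun p _ => ?_
    let e : J ≃ J :=
      { toFun := fun y => D.lact h⁻¹ (D.ract y h)
        invFun := fun y => D.lact h (D.ract y h⁻¹)
        left_inv := fun y => by simp only [D.ract_lact, D.ract_ract_inv, D.lact_lact_inv]
        right_inv := fun y => by simp only [D.ract_lact, D.ract_inv_ract, D.lact_inv_lact] }
    exact Fintype.sum_equiv e _ _ fun y => rfl
  · rw [hθ h hh, zero_mul, mul_zero]
    refine Finset.sum_eq_zero fun s _ => ?_
    obtain ⟨p, y, rfl⟩ := D.exists_eq s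
    obtain ⟨z, u, h1, -⟩ := D.exists_conj_eq p h x y
    rw [h1, xi, D.dec_apply, if_neg]
    exact fun h2 => hh (D.conj_mem_Hset_iff.1 h2.1)

end Characters

section IsCharacter

variable [Fintype L] [SMulCommClass F J J] [IsScalarTower F J J]
  (D : AlgebraGroupExtension F J L G)

omit [Fintype L] [SMulCommClass F J J] [IsScalarTower F J J] in
theorem dec_one : D.dec 1 = (1, 0) := by
  rw [← D.dec_apply 1 0, map_one, D.em_zero, one_mul]

omit [Fintype L] in
theorem conj_mem_Jrt {l : Module.Dual F J} {k : L} (hk : k ∈ D.Hset l) {x : J} (hx : x ∈ Jrt l) :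
    D.lact k⁻¹ (D.ract x k) ∈ Jrt l := fun w => by
  have h1 := hk l (D.mem_orbit_self l) (x * D.lact k (D.ract w k⁻¹))
  rw [hx, D.lact_mul_left, D.ract_mul_right, D.ract_lact, D.ract_inv_ract, D.mul_lact] at h1
  rwa [← D.ract_lact]

omit [Fintype L] in
/-- `H_{GλG} ⋉ U_{λ,rt}` as a submonoid of `G`. -/
noncomputable def HUSubmonoid (l : Module.Dual F J) : Submonoid G where
  carrier := {s | (D.dec s).1 ∈ D.Hset l ∧ (D.dec s).2 ∈ Jrt l}
  one_mem' := by
    change (D.dec 1).1 ∈ D.Hset l ∧ (D.dec 1).2 ∈ Jrt l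
    rw [D.dec_one]
    exact ⟨(D.HL l).one_mem, fun w => by simp⟩
  mul_mem' := fun {a b} ha hb => by
    obtain ⟨h, x, rfl⟩ := D.exists_eq a
    obtain ⟨k, y, rfl⟩ := D.exists_eq b
    change (D.dec (_ * _)).1 ∈ D.Hset l ∧ (D.dec (_ * _)).2 ∈ Jrt l at ha hb ⊢
    rw [D.dec_apply] at ha hb
    rw [D.mul_apply, D.dec_apply]
    have hx := D.conj_mem_Jrt hb.1 ha.2
    exact ⟨(D.HL l).mul_mem ha.1 hb.1, fun w => by
      rw [add_mul, add_mul, mul_assoc, map_add, map_add, hx, hb.2 w, hx, add_zero, add_zero]⟩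

variable [Fintype G]

/-- The subgroup `H_{GλG} ⋉ U_{λ,rt}`. -/
noncomputable def HU (l : Module.Dual F J) : Subgroup G :=
  { D.HUSubmonoid l with
    inv_mem' := fun {a} ha => by
      have hM : a ^ (orderOf a - 1) ∈ D.HUSubmonoid l := pow_mem ha _
      have : a⁻¹ = a ^ (orderOf a - 1) := by
        rw [inv_eq_iff_mul_eq_one, ← pow_succ', Nat.sub_add_cancel (orderOf_pos a),
          pow_orderOf_eq_one]
      change a⁻¹ ∈ D.HUSubmonoid l
      rwa [this] }

omit [Fintype L] in
theorem mem_HU {l : Module.Dual F J} {s : G} :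
    s ∈ D.HU l ↔ (D.dec s).1 ∈ D.Hset l ∧ (D.dec s).2 ∈ Jrt l := Iff.rfl

omit [Fintype L] in
theorem card_HU (l : Module.Dual F J) :
    Nat.card (D.HU l) = Nat.card ↥(D.Hset l) * Nat.card ↥(Jrt l) := by
  rw [← Nat.card_prod]
  symm
  refine Nat.card_congr (Equiv.ofBijective (fun q => ⟨D.ρ q.1 * D.em q.2, ?_⟩) ⟨?_, ?_⟩)
  · rw [mem_HU, D.dec_apply]
    exact ⟨q.1.2, q.2.2⟩
  · intro q q' h
    have := D.split.1 (a₁ := (q.1.1, q.2.1)) (a₂ := (q'.1.1, q'.2.1)) (congrArg Subtype.val h)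
    exact Prod.ext (Subtype.ext (congrArg Prod.fst this)) (Subtype.ext (congrArg Prod.snd this))
  · rintro ⟨s, hs⟩
    obtain ⟨h, x, rfl⟩ := D.exists_eq s
    rw [mem_HU, D.dec_apply] at hs
    exact ⟨(⟨h, hs.1⟩, ⟨x, hs.2⟩), rfl⟩

omit [Fintype L] in
/-- The representation of `H_{GλG} ⋉ U_{λ,rt}` with character `h(1+x) ↦ ψ(h) ε^{(pλ)(x)}`. -/
theorem exists_rep_HU (ε : AddChar F ℂ) (l : Module.Dual F J) (W : FDRep ℂ (D.HL l)) (p : L) :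
    ∃ V : FDRep ℂ (D.HU l), ∀ s : D.HU l,
      V.character s = W.character ⟨(D.dec s).1, s.2.1⟩ * ε (l (D.ract (D.dec s).2 p)) := by
  let R : D.HU l →* (W →ₗ[ℂ] W) :=
    { toFun := fun s => ε (l (D.ract (D.dec s).2 p)) • W.ρ ⟨(D.dec s).1, s.2.1⟩
      map_one' := by
        have h1 : (⟨(D.dec ((1 : D.HU l) : G)).1, (1 : D.HU l).2.1⟩ : D.HL l) = 1 :=
          Subtype.ext (congrArg Prod.fst D.dec_one)
        have h2 : (D.dec ((1 : D.HU l) : G)).2 = 0 := congrArg Prod.snd D.dec_one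
        rw [h1, h2, map_one, (D.ract_linear p).map_zero, map_zero, AddChar.map_zero_eq_one,
          one_smul]
      map_mul' := by
        rintro ⟨s, hs⟩ ⟨t, ht⟩
        obtain ⟨h, x, rfl⟩ := D.exists_eq s
        obtain ⟨k, y, rfl⟩ := D.exists_eq t
        have hs' := hs
        have ht' := ht
        rw [mem_HU, D.dec_apply] at hs' ht'
        have h1 : (⟨_, ((⟨_, hs⟩ : D.HU l) * ⟨_, ht⟩).2.1⟩ : D.HL l) =
            ⟨_, hs.1⟩ * ⟨_, ht.1⟩ := Subtype.ext (by
          simp only [Subgroup.coe_mul, D.mul_apply, D.dec_apply])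
        have h2 := ht'.1 _ (D.tr_mem_orbit 1 (D.ρ p) l) x
        simp only [tr_apply, D.lG_one, D.rG_rho] at h2
        have h3 := D.conj_mem_Jrt ht'.1 hs'.2 (D.ract y p)
        rw [← D.ract_lact] at h3
        rw [h1, map_mul, smul_mul_smul_comm]
        congr 1
        simp only [Subgroup.coe_mul, D.mul_apply, D.dec_apply, D.ract_add, D.ract_mul_right,
          map_add, AddChar.map_add_eq_mul, ← D.ract_lact, h2, h3, AddChar.map_zero_eq_one,
          mul_one] }
  refine ⟨FDRep.of R, fun s => ?_⟩
  change LinearMap.trace ℂ W (ε (l (D.ract (D.dec s).2 p)) • W.ρ ⟨(D.dec s).1, s.2.1⟩) = _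
  rw [map_smul, smul_eq_mul, mul_comm]
  rfl

theorem exists_character_eq_chi (ε : AddChar F ℂ) {θ : L → ℂ} {l : Module.Dual F J}
    (hθ : IsOrbitSum (D.Hset l) θ) : ∃ W : FDRep ℂ G, ∀ g, D.chi ε θ l g = W.character g := by
  obtain ⟨S, h1, -, h3⟩ := hθ
  let f : (L → ℂ) × L → G → ℂ := fun i g => (Nat.card (D.HU l) : ℂ)⁻¹ * ∑ s : G,
    if s * g * s⁻¹ ∈ D.HU l then
      i.1 (D.dec (s * g * s⁻¹)).1 * ε (l (D.ract (D.dec (s * g * s⁻¹)).2 i.2)) else 0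
  obtain ⟨W, hW⟩ := FDRep.exists_character_eq_sum (S ×ˢ Finset.univ) f fun i hi => by
    have hψ : IsIrrOn (D.HL l : Set L) i.1 := h1 _ (Finset.mem_product.1 hi).1
    obtain ⟨W, -, eW⟩ := hψ.exists_fdRep
    obtain ⟨V, hV⟩ := D.exists_rep_HU ε l W i.2
    obtain ⟨X, hX⟩ := FDRep.exists_character_eq_induced (D.HU l) V
    refine ⟨X, fun g => ?_⟩
    rw [hX]
    simp only [f]
    congr 1
    refine Finset.sum_congr rfl fun s _ => ?_
    split_ifs with h
    · rw [hV, ← eW]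
    · rfl
  refine ⟨W, fun g => ?_⟩
  rw [← hW, ← Finset.mul_sum, Finset.sum_comm, chi, ← D.card_HU]
  congr 1
  refine Finset.sum_congr rfl fun s _ => ?_
  simp only [xi, mem_HU]
  split_ifs with h
  · rw [Finset.sum_product_right]
    simp only [h3, Finset.sum_mul]
  · simp

end IsCharacter

section Superclasses

variable [SMulCommClass F J J] [IsScalarTower F J J] (D : AlgebraGroupExtension F J L G)

/-- The preimage in `J` of the `G × G`-orbit of `x₀` in `J / J_h`. -/
def cell (h : L) (x₀ : J) : Set J := {y : J | ∃ z ∈ D.orb2 x₀, y - z ∈ D.Jh h}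

/-- The superclass attached to `β`. -/
def K (β : L × Set J) : Set G :=
  {g : G | ∃ (r : L), ∃ x ∈ β.2, g = D.ρ (r * β.1 * r⁻¹) * D.em x}

/-- The index set of the superclasses. -/
def B (Rcl : Set L) : Set (L × Set J) :=
  {β | β.1 ∈ Rcl ∧ ∃ x₀ : J, β.2 = {y : J | ∃ z ∈ D.orb2 x₀, y - z ∈ D.Jh β.1}}

theorem mem_cell {h : L} {x y : J} : y ∈ D.cell h x ↔ ∃ a b, y - D.rG b (D.lG a x) ∈ D.Jh h := by
  constructor
  · rintro ⟨z, hz, hy⟩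
    obtain ⟨a, b, rfl⟩ := D.mem_orb2.1 hz
    exact ⟨a, b, hy⟩
  · rintro ⟨a, b, hy⟩
    exact ⟨_, D.mem_orb2.2 ⟨a, b, rfl⟩, hy⟩

theorem zero_mem_Jh (h : L) : (0 : J) ∈ D.Jh h := D.mem_Jh.2 fun μ _ => map_zero μ

theorem mem_cell_self (h : L) (x : J) : x ∈ D.cell h x :=
  D.mem_cell.2 ⟨1, 1, by rw [D.lG_one, D.rG_one, sub_self]; exact D.zero_mem_Jh h⟩

theorem mem_cell_symm {h : L} {x y : J} (hy : y ∈ D.cell h x) : x ∈ D.cell h y := by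
  obtain ⟨a, b, hy⟩ := D.mem_cell.1 hy
  refine D.mem_cell.2 ⟨a⁻¹, b⁻¹, D.mem_Jh.2 fun μ hμ => ?_⟩
  have := D.mem_Jh.1 (D.rG_lG_mem_Jh a⁻¹ b⁻¹ hy) μ hμ
  rw [map_sub, map_sub, ← D.rG_lG a⁻¹ b, ← D.lG_mul, ← D.rG_mul, inv_mul_cancel,
    mul_inv_cancel, D.lG_one, D.rG_one] at this
  rw [← neg_sub, map_neg, this, neg_zero]

theorem mem_cell_trans {h : L} {x y z : J} (hy : y ∈ D.cell h x) (hz : z ∈ D.cell h y) :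
    z ∈ D.cell h x := by
  obtain ⟨a, b, hy⟩ := D.mem_cell.1 hy
  obtain ⟨c, d, hz⟩ := D.mem_cell.1 hz
  refine D.mem_cell.2 ⟨c * a, b * d, D.mem_Jh.2 fun μ hμ => ?_⟩
  have h1 := D.mem_Jh.1 hz μ hμ
  have h2 := D.mem_Jh.1 (D.rG_lG_mem_Jh c d hy) μ hμ
  rw [map_sub, map_sub, ← D.rG_lG c b, ← D.lG_mul, ← D.rG_mul] at h2
  rw [← sub_add_sub_cancel, map_add, h1, h2, add_zero]

theorem cell_eq {h : L} {x y : J} (hy : y ∈ D.cell h x) : D.cell h y = D.cell h x :=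
  Set.ext fun _ => ⟨D.mem_cell_trans hy, D.mem_cell_trans (D.mem_cell_symm hy)⟩

theorem cell_conj (h r : L) (x : J) : D.cell (r * h * r⁻¹) x = D.cell h x := by
  rw [cell, cell, D.Jh_conj]

omit [SMulCommClass F J J] [IsScalarTower F J J] in
theorem mem_K {β : L × Set J} {k : L} {x : J} :
    D.ρ k * D.em x ∈ D.K β ↔ (∃ r, k = r * β.1 * r⁻¹) ∧ x ∈ β.2 := by
  constructor
  · rintro ⟨r, y, hy, e⟩
    have := D.split.1 (a₁ := (k, x)) (a₂ := (r * β.1 * r⁻¹, y)) e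
    rw [Prod.mk.injEq] at this
    exact ⟨⟨r, this.1⟩, this.2 ▸ hy⟩
  · rintro ⟨⟨r, rfl⟩, hx⟩
    exact ⟨r, x, hx, rfl⟩

theorem existsUnique_mem_K {Rcl : Set L}
    (hRcl : ∀ k : L, ∃! h, h ∈ Rcl ∧ ∃ r : L, k = r * h * r⁻¹) (g : G) :
    ∃! β, β ∈ D.B Rcl ∧ g ∈ D.K β := by
  obtain ⟨k, x, rfl⟩ := D.exists_eq g
  obtain ⟨h, ⟨hh, hr⟩, hu⟩ := hRcl k
  refine ⟨(h, D.cell h x), ⟨⟨hh, x, rfl⟩, D.mem_K.2 ⟨hr, D.mem_cell_self h x⟩⟩, ?_⟩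
  rintro ⟨h', ω⟩ ⟨⟨hh', x₀, e⟩, hK⟩
  obtain ⟨hr', hx⟩ := D.mem_K.1 hK
  obtain rfl := hu h' ⟨hh', hr'⟩
  change ω = D.cell h' x₀ at e
  subst e
  rw [D.cell_eq hx]

theorem Jh_one [Finite J] : D.Jh 1 = {0} := by
  ext x
  rw [mem_Jh, Set.mem_singleton_iff]
  refine ⟨fun hx => ?_, fun hx μ _ => hx ▸ map_zero μ⟩
  rw [← Module.forall_dual_apply_eq_zero_iff F]
  exact fun μ => hx μ (D.mem_Mh.2 (D.HL μ).one_mem)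

theorem exists_K_eq_one [Finite J] {Rcl : Set L}
    (hRcl : ∀ k : L, ∃! h, h ∈ Rcl ∧ ∃ r : L, k = r * h * r⁻¹) :
    ∃ β ∈ D.B Rcl, D.K β = {1} := by
  obtain ⟨h, ⟨hh, r, e⟩, -⟩ := hRcl 1
  obtain rfl : h = 1 := by simpa [eq_comm, mul_inv_eq_one] using e
  refine ⟨(1, D.cell 1 0), ⟨hh, 0, rfl⟩, ?_⟩
  ext g
  obtain ⟨k, x, rfl⟩ := D.exists_eq g
  rw [mem_K, mem_cell, D.Jh_one, Set.mem_singleton_iff]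
  simp only [map_zero, sub_zero, Set.mem_singleton_iff, mul_one, mul_inv_cancel, exists_const]
  constructor
  · rintro ⟨rfl, rfl⟩
    rw [map_one, D.em_zero, one_mul]
  · intro e
    have := D.split.1 (a₁ := (k, x)) (a₂ := (1, 0)) (by simpa [D.em_zero] using e)
    simpa using this

end Superclasses

section SupercharacterTheory

variable [Fintype J] [Fintype L] [Fintype G] [SMulCommClass F J J] [IsScalarTower F J J]
  (D : AlgebraGroupExtension F J L G) {ε : AddChar F ℂ}

/-- The index set of the supercharacters. -/
def A (R : Set (Module.Dual F J)) : Set ((L → ℂ) × Module.Dual F J) :=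
  {α | α.2 ∈ R ∧ IsOrbitSum (D.Hset α.2) α.1}

instance normal_HL (l : Module.Dual F J) : (D.HL l).Normal :=
  ⟨fun _ hh k => D.conj_mem_Hset hh k⟩

omit [Fintype J] [Fintype L] in
theorem Phi_eq_sum_prod (l : Module.Dual F J) (x : J) :
    D.Phi ε l x = ∑ q : G × G, ε (D.tr q.1 q.2 l x) :=
  (Fintype.sum_prod_type' fun a b => ε (D.tr a b l x)).symm

omit [Fintype L] in
theorem sum_Phi_mul_conj_eq_zero [Finite F] (hε : ε ≠ 1) {l l' : Module.Dual F J}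
    (h : l' ∉ D.orbit l) : ∑ x, D.Phi ε l x * (starRingEnd ℂ) (D.Phi ε l' x) = 0 := by
  have key : ∀ a b a' b', ∑ x, ε (D.tr a b l x) * (starRingEnd ℂ) (ε (D.tr a' b' l' x)) = 0 := by
    intro a b a' b'
    have hne : D.tr a b l - D.tr a' b' l' ≠ 0 := fun h0 => h <| by
      have := D.tr_mem_orbit a' b' l'
      rw [← sub_eq_zero.1 h0] at this
      rw [← D.orbit_eq (D.tr_mem_orbit a b l), D.orbit_eq this]
      exact D.mem_orbit_self l'
    rw [← sum_addChar_eq_zero hε hne]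
    refine Finset.sum_congr rfl fun x _ => ?_
    rw [← AddChar.map_neg_eq_conj, ← AddChar.map_add_eq_mul, LinearMap.sub_apply, sub_eq_add_neg]
  simp only [Phi_eq_sum_prod, map_sum, Finset.sum_mul_sum]
  rw [Finset.sum_comm]
  refine Finset.sum_eq_zero fun q _ => ?_
  rw [Finset.sum_comm]
  exact Finset.sum_eq_zero fun q' _ => key _ _ _ _

theorem sum_chi_mul_conj_eq_zero [Finite F] (hε : ε ≠ 1) {R : Set (Module.Dual F J)}
    (hR : ∀ μ : Module.Dual F J, ∃! l, l ∈ R ∧ μ ∈ D.orbit l) {α α' : (L → ℂ) × Module.Dual F J}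
    (hα : α ∈ D.A R) (hα' : α' ∈ D.A R) (hne : α ≠ α') :
    ∑ g, D.chi ε α.1 α.2 g * (starRingEnd ℂ) (D.chi ε α'.1 α'.2 g) = 0 := by
  obtain ⟨θ, l⟩ := α
  obtain ⟨θ', l'⟩ := α'
  obtain ⟨hl, hθ⟩ := hα
  obtain ⟨hl', hθ'⟩ := hα'
  simp only at *
  have e : ∀ h x, D.chi ε θ l (D.ρ h * D.em x) *
      (starRingEnd ℂ) (D.chi ε θ' l' (D.ρ h * D.em x)) =
      (((Nat.card ↥(D.Hset l) * Nat.card ↥(Jrt l) : ℕ) : ℂ)⁻¹ * (Fintype.card J : ℂ)⁻¹ *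
        (starRingEnd ℂ) (((Nat.card ↥(D.Hset l') * Nat.card ↥(Jrt l') : ℕ) : ℂ)⁻¹ *
          (Fintype.card J : ℂ)⁻¹)) * ((θ h * (starRingEnd ℂ) (θ' h)) *
        (D.Phi ε l x * (starRingEnd ℂ) (D.Phi ε l' x))) := fun h x => by
    rw [D.chi_apply hε (fun h => hθ.eq_zero) hθ.apply_conj,
      D.chi_apply hε (fun h => hθ'.eq_zero) hθ'.apply_conj, map_mul (starRingEnd ℂ),
      map_mul (starRingEnd ℂ) (θ' h)]
    ring
  rw [D.sum_eq_sum_sum]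
  simp only [e, ← Finset.mul_sum, ← Finset.sum_mul]
  refine mul_eq_zero_of_right _ ?_
  by_cases h : l = l'
  · subst h
    refine mul_eq_zero_of_left (IsOrbitSum.sum_mul_conj_eq_zero (H := D.HL l) hθ hθ' fun h => ?_) _
    exact hne (by rw [h])
  · refine mul_eq_zero_of_right _ (D.sum_Phi_mul_conj_eq_zero hε fun h1 => h ?_)
    exact (hR l').unique ⟨hl, h1⟩ ⟨hl', D.mem_orbit_self l'⟩

omit [Fintype J] [Fintype L] in
theorem Phi_rG_lG (l : Module.Dual F J) (x : J) (c d : G) :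
    D.Phi ε l (D.rG d (D.lG c x)) = D.Phi ε l x := by
  refine Fintype.sum_equiv (Equiv.mulRight c) _ _ fun a =>
    Fintype.sum_equiv (Equiv.mulLeft d) _ _ fun b => ?_
  rw [Equiv.coe_mulRight, Equiv.coe_mulLeft, tr_apply, tr_apply, D.lG_mul, D.rG_mul, D.rG_lG a d]

omit [Fintype J] [Fintype L] in
theorem Phi_eq_of_mem_cell {l : Module.Dual F J} {h : L} (hh : h ∈ D.Hset l) {x y : J}
    (hy : y ∈ D.cell h x) : D.Phi ε l y = D.Phi ε l x := by
  obtain ⟨c, d, hy⟩ := D.mem_cell.1 hy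
  rw [← D.Phi_rG_lG l x c d]
  refine Finset.sum_congr rfl fun a _ => Finset.sum_congr rfl fun b _ => ?_
  congr 1
  rw [← sub_eq_zero, ← map_sub]
  exact D.mem_Jh.1 hy _ (D.tr_mem_Mh a b hh)

theorem chi_eq_of_mem_K (hε : ε ≠ 1) {θ : L → ℂ} {l : Module.Dual F J}
    (hθ : IsOrbitSum (D.Hset l) θ) {Rcl : Set L} {β : L × Set J} (hβ : β ∈ D.B Rcl) {g g' : G}
    (hg : g ∈ D.K β) (hg' : g' ∈ D.K β) : D.chi ε θ l g = D.chi ε θ l g' := by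
  obtain ⟨h, ω⟩ := β
  obtain ⟨-, x₀, e⟩ := hβ
  obtain ⟨r, x, hx, rfl⟩ := hg
  obtain ⟨r', x', hx', rfl⟩ := hg'
  change ω = D.cell h x₀ at e
  subst e
  rw [D.chi_apply hε (fun h => hθ.eq_zero) hθ.apply_conj,
    D.chi_apply hε (fun h => hθ.eq_zero) hθ.apply_conj, hθ.apply_conj, hθ.apply_conj]
  congr 1
  by_cases hh : h ∈ D.Hset l
  · rw [D.Phi_eq_of_mem_cell hh hx, D.Phi_eq_of_mem_cell hh hx']
  · simp only [hθ.eq_zero hh, zero_mul]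

omit [Fintype L] in
omit [Fintype J] in
theorem Phi_zero (l : Module.Dual F J) : D.Phi ε l 0 = (Fintype.card G : ℂ) * Fintype.card G := by
  simp [Phi]

omit [Fintype G] [SMulCommClass F J J] [IsScalarTower F J J] in
theorem coeff_ne_zero (l : Module.Dual F J) :
    ((Nat.card ↥(D.Hset l) * Nat.card ↥(Jrt l) : ℕ) : ℂ)⁻¹ * (Fintype.card J : ℂ)⁻¹ ≠ 0 := by
  have : Nonempty (D.Hset l) := ⟨⟨1, (D.HL l).one_mem⟩⟩
  have : Nonempty (Jrt l) := ⟨⟨0, fun w => by simp⟩⟩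
  refine mul_ne_zero (inv_ne_zero (Nat.cast_ne_zero.2 (mul_ne_zero ?_ ?_)))
    (inv_ne_zero (Nat.cast_ne_zero.2 Fintype.card_ne_zero))
  all_goals exact Nat.card_pos.ne'

theorem chi_ne_zero (hε : ε ≠ 1) {θ : L → ℂ} {l : Module.Dual F J}
    (hθ : IsOrbitSum (D.Hset l) θ) : D.chi ε θ l ≠ 0 := fun h0 => by
  have h1 := congrFun h0 (D.ρ 1 * D.em 0)
  have hc : (Fintype.card G : ℂ) ≠ 0 := Nat.cast_ne_zero.2 Fintype.card_ne_zero
  rw [D.chi_apply hε (fun h => hθ.eq_zero) hθ.apply_conj, D.Phi_zero] at h1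
  exact mul_ne_zero (D.coeff_ne_zero l)
    (mul_ne_zero (IsOrbitSum.apply_one_ne_zero (H := D.HL l) hθ) (mul_ne_zero hc hc)) h1

/-- The map `x ↦ a x b` as a permutation of `J`. -/
noncomputable def biact (a b : G) : J ≃ J where
  toFun x := D.rG b (D.lG a x)
  invFun x := D.rG b⁻¹ (D.lG a⁻¹ x)
  left_inv x := by
    change D.rG b⁻¹ (D.lG a⁻¹ (D.rG b (D.lG a x))) = x
    rw [← D.rG_lG a⁻¹ b, ← D.lG_mul, ← D.rG_mul, inv_mul_cancel, mul_inv_cancel, D.lG_one,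
      D.rG_one]
  right_inv x := by
    change D.rG b (D.lG a (D.rG b⁻¹ (D.lG a⁻¹ x))) = x
    rw [← D.rG_lG a b⁻¹, ← D.lG_mul, ← D.rG_mul, mul_inv_cancel, inv_mul_cancel, D.lG_one,
      D.rG_one]

/-- The Fourier coefficient at `μ` of the restriction of `f` to the coset of `h`. -/
noncomputable def coeff (ε : AddChar F ℂ) (f : G → ℂ) (μ : Module.Dual F J) (h : L) : ℂ :=
  ∑ x, f (D.ρ h * D.em x) * (starRingEnd ℂ) (ε (μ x))

section Complete

variable {f : G → ℂ}
  (hf : ∀ r h x y, y ∈ D.cell h x → f (D.ρ (r * h * r⁻¹) * D.em y) = f (D.ρ h * D.em x))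

include hf

omit [Fintype J] [Fintype L] [Fintype G] [SMulCommClass F J J] [IsScalarTower F J J] in
theorem apply_eq_of_mem_cell {h : L} {x y : J} (hy : y ∈ D.cell h x) :
    f (D.ρ h * D.em y) = f (D.ρ h * D.em x) := by
  simpa using hf 1 h x y hy

omit [Fintype L] [Fintype G] in
theorem coeff_tr (a b : G) (l : Module.Dual F J) (h : L) :
    D.coeff ε f (D.tr a b l) h = D.coeff ε f l h := by
  refine Fintype.sum_equiv (D.biact a b) _ _ fun x => ?_
  congr 1
  refine (D.apply_eq_of_mem_cell hf (D.mem_cell.2 ⟨a, b, ?_⟩)).symm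
  change D.rG b (D.lG a x) - _ ∈ _
  rw [sub_self]
  exact D.zero_mem_Jh h

omit [Fintype L] [Fintype G] in
theorem coeff_conj (l : Module.Dual F J) (r h : L) :
    D.coeff ε f l (r * h * r⁻¹) = D.coeff ε f l h :=
  Finset.sum_congr rfl fun x _ => by rw [hf r h x x (D.mem_cell_self h x)]

omit [Fintype L] [Fintype G] in
theorem coeff_eq_zero_of_notMem (hε : ε ≠ 1) {μ : Module.Dual F J} {h : L} (hh : h ∉ D.Hset μ) :
    D.coeff ε f μ h = 0 := by
  obtain ⟨z, hz, hne⟩ : ∃ z ∈ D.Jh h, μ z ≠ 0 := by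
    by_contra! h0
    exact hh (D.mem_Mh_of_forall_Jh h0)
  obtain ⟨t, ht⟩ : ∃ t, ε t ≠ 1 := AddChar.ne_one_iff.1 hε
  set z' := (t / μ z) • z with hz'
  have h1 : μ z' = t := by rw [hz', map_smul, smul_eq_mul, div_mul_cancel₀ _ hne]
  have h2 : z' ∈ D.Jh h := D.mem_Jh.2 fun ν hν => by
    rw [hz', map_smul, D.mem_Jh.1 hz ν hν, smul_zero]
  have h3 : D.coeff ε f μ h = D.coeff ε f μ h * (starRingEnd ℂ) (ε t) := by
    rw [coeff, Finset.sum_mul]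
    refine (Fintype.sum_equiv (Equiv.addRight z') _ _ fun x => ?_).symm
    rw [Equiv.coe_addRight, map_add, AddChar.map_add_eq_mul, map_mul, h1, mul_assoc]
    congr 1
    refine (D.apply_eq_of_mem_cell hf (D.mem_cell.2 ⟨1, 1, ?_⟩)).symm
    rwa [D.lG_one, D.rG_one, add_sub_cancel_left]
  by_contra h0
  refine ht ?_
  have h4 := mul_left_cancel₀ h0 ((mul_one _).trans h3)
  simpa using (congrArg (starRingEnd ℂ) h4).symm

omit [Fintype L] in
theorem sum_mul_conj_Phi (l : Module.Dual F J) (h : L) :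
    ∑ x, f (D.ρ h * D.em x) * (starRingEnd ℂ) (D.Phi ε l x) =
      (Fintype.card G * Fintype.card G : ℂ) * D.coeff ε f l h := by
  simp only [Phi_eq_sum_prod, map_sum, Finset.mul_sum]
  rw [Finset.sum_comm]
  change ∑ q : G × G, D.coeff ε f (D.tr q.1 q.2 l) h = _
  simp [D.coeff_tr hf]

theorem eq_zero_of_forall_sum_chi [Finite F] (hε : ε ≠ 1) {R : Set (Module.Dual F J)}
    (hR : ∀ μ : Module.Dual F J, ∃! l, l ∈ R ∧ μ ∈ D.orbit l)
    (h0 : ∀ α ∈ D.A R, ∑ g, f g * (starRingEnd ℂ) (D.chi ε α.1 α.2 g) = 0) : f = 0 := by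
  have key : ∀ l ∈ R, ∀ h ∈ D.Hset l, D.coeff ε f l h = 0 := fun l hl h hh => by
    refine IsOrbitSum.eq_zero_of_forall (H := D.HL l) _ (D.coeff_conj hf l) (fun θ hθ => ?_) hh
    have hθ' : IsOrbitSum (D.Hset l) θ := hθ
    have h1 := h0 (θ, l) ⟨hl, hθ⟩
    have e : ∀ h x, f (D.ρ h * D.em x) * (starRingEnd ℂ) (D.chi ε θ l (D.ρ h * D.em x)) =
        (starRingEnd ℂ) (((Nat.card ↥(D.Hset l) * Nat.card ↥(Jrt l) : ℕ) : ℂ)⁻¹ *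
          (Fintype.card J : ℂ)⁻¹) * ((starRingEnd ℂ) (θ h) *
          (f (D.ρ h * D.em x) * (starRingEnd ℂ) (D.Phi ε l x))) := fun h x => by
      rw [D.chi_apply hε (fun h => hθ'.eq_zero) hθ'.apply_conj, map_mul (starRingEnd ℂ),
        map_mul (starRingEnd ℂ) (θ h)]
      ring
    have hc : (Fintype.card G : ℂ) ≠ 0 := Nat.cast_ne_zero.2 Fintype.card_ne_zero
    rw [D.sum_eq_sum_sum] at h1
    simp only [e, ← Finset.mul_sum, D.sum_mul_conj_Phi hf,
      mul_left_comm ((starRingEnd ℂ) (θ _)) (_ * _)] at h1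
    have h2 := (mul_eq_zero.1 h1).resolve_left
      ((map_ne_zero (starRingEnd ℂ)).2 (D.coeff_ne_zero l))
    simpa only [mul_comm] using (mul_eq_zero.1 h2).resolve_left (mul_ne_zero hc hc)
  funext g
  obtain ⟨h, x, rfl⟩ := D.exists_eq g
  refine congrFun (eq_zero_of_forall_sum_addChar hε (fun x => f (D.ρ h * D.em x)) fun μ => ?_) x
  change D.coeff ε f μ h = 0
  by_cases hh : h ∈ D.Hset μ
  · obtain ⟨l, ⟨hl, hμ⟩, -⟩ := hR μ
    rw [D.Hset_eq hμ] at hh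
    obtain ⟨a, b, rfl⟩ := D.mem_orbit.1 hμ
    rw [D.coeff_tr hf, key l hl h hh]
  · exact D.coeff_eq_zero_of_notMem hf hε hh

end Complete

theorem card_A_eq_card_B [Finite F] (hε : ε ≠ 1) {R : Set (Module.Dual F J)}
    (hR : ∀ μ : Module.Dual F J, ∃! l, l ∈ R ∧ μ ∈ D.orbit l) {Rcl : Set L}
    (hRcl : ∀ k : L, ∃! h, h ∈ Rcl ∧ ∃ r : L, k = r * h * r⁻¹) :
    Nat.card ↥(D.A R) = Nat.card ↥(D.B Rcl) := by
  choose b hb hbu using D.existsUnique_mem_K hRcl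
  simp only at hb hbu
  have hb' : ∀ {β g}, β ∈ D.B Rcl → g ∈ D.K β → b g = β := fun h1 h2 => (hbu _ _ ⟨h1, h2⟩).symm
  let b' : G → D.B Rcl := fun g => ⟨b g, (hb g).1⟩
  have hsurj : Function.Surjective b' := by
    rintro ⟨⟨h, ω⟩, hh, x₀, e⟩
    change ω = D.cell h x₀ at e
    subst e
    refine ⟨D.ρ h * D.em x₀, Subtype.ext (hb' ⟨hh, x₀, rfl⟩ (D.mem_K.2 ⟨⟨1, ?_⟩, ?_⟩))⟩
    · simp
    · exact D.mem_cell_self h x₀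
  refine natCard_eq_of_orthogonal_of_complete hsurj
    (fun α : D.A R => D.chi ε α.1.1 α.1.2) (fun α => D.chi_ne_zero hε α.2.2)
    (fun α α' hne => D.sum_chi_mul_conj_eq_zero hε hR α.2 α'.2 fun h => hne (Subtype.ext h))
    (fun α g g' h => ?_) fun f hf => ?_
  · refine D.chi_eq_of_mem_K hε α.2.2 (hb g).1 (hb g).2 ?_
    rw [show b g = b g' from congrArg Subtype.val h]
    exact (hb g').2
  · have h1 := D.eq_zero_of_forall_sum_chi (f := f ∘ b') ?_ hε hR fun α hα => hf ⟨α, hα⟩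
    · funext β
      obtain ⟨g, rfl⟩ := hsurj β
      exact congrFun h1 g
    · intro r h x y hy
      refine congrArg f (Subtype.ext ?_)
      change b _ = b _
      obtain ⟨h', ⟨hh', q, rfl⟩, -⟩ := hRcl h
      rw [D.cell_conj] at hy
      have hβ : (h', D.cell h' x) ∈ D.B Rcl := ⟨hh', x, rfl⟩
      rw [hb' hβ (D.mem_K.2 ⟨⟨r * q, by group⟩, hy⟩),
        hb' hβ (D.mem_K.2 ⟨⟨q, rfl⟩, D.mem_cell_self h' x⟩)]

end SupercharacterTheory

end AlgebraGroupExtension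

theorem stmt_10
    (F : Type) [Field F] [Fintype F]
    (J : Type) [NonUnitalRing J] [Module F J]
    [SMulCommClass F J J] [IsScalarTower F J J] [Fintype J]
    (hnil : ∃ N : ℕ, ∀ x : ℕ → J,
      (List.range N).foldr (fun i acc => x i * acc) (x N) = 0)
    (L : Type) [Group L] [Fintype L]
    (lact : L → J → J) (ract : J → L → J)
    (hlactlin : ∀ h : L, IsLinearMap F (lact h))
    (hractlin : ∀ h : L, IsLinearMap F (fun x => ract x h))
    (hlact_one : ∀ x : J, lact 1 x = x)
    (hlact_mul : ∀ h k : L, ∀ x : J, lact (h * k) x = lact h (lact k x))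
    (hract_one : ∀ x : J, ract x 1 = x)
    (hract_mul : ∀ h k : L, ∀ x : J, ract x (h * k) = ract (ract x h) k)
    (hcomm : ∀ h k : L, ∀ x : J, ract (lact h x) k = lact h (ract x k))
    (hlmul : ∀ h : L, ∀ x y : J, lact h (x * y) = lact h x * y)
    (hrmul : ∀ h : L, ∀ x y : J, ract (x * y) h = x * ract y h)
    (hmid : ∀ h : L, ∀ x y : J, x * lact h y = ract x h * y)
    (G : Type) [Group G] [Fintype G]
    (ρ : L →* G) (em : J → G)
    (hem : ∀ x y : J, em x * em y = em (x + y + x * y))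
    (hsplit : Function.Bijective (fun p : L × J => ρ p.1 * em p.2))
    (hconj : ∀ (h : L) (x : J), ρ h * em x * (ρ h)⁻¹ = em (lact h (ract x h⁻¹)))
    (ε : AddChar F ℂ) (hε : ε ≠ 1)
 :
    let dec : G → L × J :=
      @Function.invFun (L × J) G ⟨(1, 0)⟩ fun p : L × J => ρ p.1 * em p.2
    let Jrt : Module.Dual F J → Set J := fun l => {z : J | ∀ w : J, l (z * w) = 0}
    let GlaG : Module.Dual F J → Set (Module.Dual F J) := fun l =>
      {μ | ∃ (k : L) (w : J) (k' : L) (w' : J), ∀ x : J,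
        μ x = l (ract (lact k' (x + w' * x)) k +
          ract (lact k' (x + w' * x)) k * w)}
    let Fix : L → Module.Dual F J → Prop := fun r μ =>
      ∀ x : J, μ (ract (lact r⁻¹ x) r) = μ x
    let Hset : Module.Dual F J → Set L := fun l => {r : L | ∀ μ ∈ GlaG l, Fix r μ}
    let ξdot : (L → ℂ) → Module.Dual F J → G → ℂ := fun θ l s =>
      if (dec s).1 ∈ Hset l ∧ (dec s).2 ∈ Jrt l then
        ∑ p : L, θ (dec s).1 * ε (l (ract (dec s).2 p))
      else 0
    let χ : (L → ℂ) → Module.Dual F J → G → ℂ := fun θ l g =>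
      ((Nat.card ↥(Hset l) * Nat.card ↥(Jrt l) : ℕ) : ℂ)⁻¹ *
        ∑ s : G, ξdot θ l (s * g * s⁻¹)
    let IsIrrOn : Set L → (L → ℂ) → Prop := fun H ψ =>
      (∀ h : L, h ∉ H → ψ h = 0) ∧
      ∃ H₀ : Subgroup L, (H₀ : Set L) = H ∧
        ∃ W : FDRep ℂ ↥H₀, CategoryTheory.Simple W ∧
          ∀ h : ↥H₀, ψ ↑h = W.character h
    let IsLIrr : Module.Dual F J → (L → ℂ) → Prop := fun l θ =>
      ∃ Sfin : Finset (L → ℂ),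
        (∀ ψ ∈ Sfin, IsIrrOn (Hset l) ψ) ∧
        (∃ ψ₀ ∈ Sfin, ∀ ψ : L → ℂ,
          ψ ∈ Sfin ↔ ∃ r : L, ∀ h : L, ψ h = ψ₀ (r * h * r⁻¹)) ∧
        ∀ h : L, θ h = ∑ ψ ∈ Sfin, ψ h
    let Jh : L → Set J := fun h =>
      {x : J | ∀ μ : Module.Dual F J,
        (∃ ν : Module.Dual F J, μ ∈ GlaG ν ∧ ∀ σ ∈ GlaG ν, Fix h σ) → μ x = 0}
    let orb2 : J → Set J := fun x₀ =>
      {y : J | ∃ (k : L) (w : J) (k' : L) (w' : J),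
        y = ract (lact k (x₀ + w * x₀)) k' + ract (lact k (x₀ + w * x₀)) k' * w'}
    let K : L × Set J → Set G := fun β =>
      {g : G | ∃ (r : L), ∃ x ∈ β.2, g = ρ (r * β.1 * r⁻¹) * em x}
    ∀ R : Set (Module.Dual F J),
      (∀ μ : Module.Dual F J, ∃! l, l ∈ R ∧ μ ∈ GlaG l) →
    ∀ Rcl : Set L,
      (∀ k : L, ∃! h, h ∈ Rcl ∧ ∃ r : L, k = r * h * r⁻¹) →
    let A : Set ((L → ℂ) × Module.Dual F J) :=
      {α | α.2 ∈ R ∧ IsLIrr α.2 α.1}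
    let B : Set (L × Set J) :=
      {β | β.1 ∈ Rcl ∧ ∃ x₀ : J,
        β.2 = {y : J | ∃ z ∈ orb2 x₀, y - z ∈ Jh β.1}}
    (∀ α ∈ A, ∃ W : FDRep ℂ G, ∀ g : G, χ α.1 α.2 g = W.character g) ∧
    (∀ α ∈ A, ∀ α' ∈ A, α ≠ α' →
      (Fintype.card G : ℂ)⁻¹ *
        (∑ g : G, χ α.1 α.2 g * (starRingEnd ℂ) (χ α'.1 α'.2 g)) = 0) ∧
    (∀ g : G, ∃! β, β ∈ B ∧ g ∈ K β) ∧
    (∃ β ∈ B, K β = {1}) ∧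
    (∀ α ∈ A, ∀ β ∈ B, ∀ g ∈ K β, ∀ g' ∈ K β, χ α.1 α.2 g = χ α.1 α.2 g') ∧
    Nat.card ↥A = Nat.card ↥B := by
  intro dec Jrt GlaG Fix Hset ξdot χ IsIrrOn IsLIrr Jh orb2 K R hR Rcl hRcl A B
  let D : AlgebraGroupExtension F J L G :=
    ⟨lact, ract, hlactlin, hractlin, hlact_one, hlact_mul, hract_one, hract_mul, hcomm, hlmul,
      hrmul, hmid, ρ, em, hem, hsplit, hconj⟩
  have hξ : ∀ θ l s, ξdot θ l s = D.xi ε θ l s := fun θ l s => if_congr Iff.rfl rfl rfl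
  have hχ : ∀ θ l g, χ θ l g = D.chi ε θ l g := fun θ l g =>
    congrArg (_ * ·) (Finset.sum_congr rfl fun s _ => hξ θ l _)
  refine ⟨fun α hα => ?_, fun α hα α' hα' hne => ?_, D.existsUnique_mem_K hRcl,
    D.exists_K_eq_one hRcl, fun α hα β hβ g hg g' hg' => ?_, D.card_A_eq_card_B hε hR hRcl⟩
  · simp only [hχ]
    exact D.exists_character_eq_chi ε hα.2
  · simp only [hχ]
    exact mul_eq_zero_of_right _ (D.sum_chi_mul_conj_eq_zero hε hR hα hα' hne)
  · simp only [hχ]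
    exact D.chi_eq_of_mem_K hε hα.2 hβ hg hg'
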